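/- For every integer s ≥ 2, the F_2-vector space (QP_5)_{7·2^s − 5} has dimension 1245. -/

import Mathlib

open MvPolynomial

noncomputable section

/-- The polynomial algebra `P_5 = F_2[x_1,...,x_5]`. -/
abbrev P5 : Type := MvPolynomial (Fin 5) (ZMod 2)

/-- The total Steenrod square: the `F_2`-algebra endomorphism with `Sq (x_i) = x_i + x_i ^ 2`. -/
def Sq : P5 →ₐ[ZMod 2] P5 := aeval fun i => X i + X i ^ 2

/-- `f` (homogeneous of degree `n`) is hit if it is the degree-`n` homogeneous component of
`Sq g` for some `g` all of whose homogeneous components have degree `< n`. -/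
def IsHit (n : ℕ) (f : P5) : Prop :=
  ∃ g : P5, (∀ m, n ≤ m → homogeneousComponent m g = 0) ∧
    f = homogeneousComponent n (Sq g)

/-- The subspace of hit polynomials of degree `n`. -/
def hitSpan (n : ℕ) : Submodule (ZMod 2) P5 :=
  Submodule.span (ZMod 2) {f : P5 | IsHit n f}

/-- The action of `GL_5(F_2)` on `P_5` by linear substitution of the variables. -/
def actGL (g : Matrix.GeneralLinearGroup (Fin 5) (ZMod 2)) : P5 →ₐ[ZMod 2] P5 :=
  aeval fun i => ∑ j, ((g : Matrix (Fin 5) (Fin 5) (ZMod 2)) i j) • X j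

/-- `wt d i` is the `(i+1)`-st entry `ω_{i+1}` of the weight vector of the monomial with
exponent vector `d`, i.e. the number of `j` such that bit `i` of `d j` is `1`. -/
def wt (d : Fin 5 →₀ ℕ) (i : ℕ) : ℕ :=
  (Finset.univ.filter fun j : Fin 5 => Nat.testBit (d j) i).card

/-- The weight vector of the exponent vector `d` equals the (finitely supported) list `w`. -/
def hasWt (d : Fin 5 →₀ ℕ) (w : List ℕ) : Prop :=
  ∀ i, wt d i = w.getD i 0

/-- The weight vector of `d` is strictly smaller than `w` in left lexicographic order. -/
def wtLt (d : Fin 5 →₀ ℕ) (w : List ℕ) : Prop :=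
  ∃ i, (∀ j, j < i → wt d j = w.getD j 0) ∧ wt d i < w.getD i 0

/-- `P_5^-(ω)`: the span of degree-`n` monomials whose weight vector is `< w`. -/
def PMinus (n : ℕ) (w : List ℕ) : Submodule (ZMod 2) P5 :=
  Submodule.span (ZMod 2)
    {x : P5 | ∃ d : Fin 5 →₀ ℕ, x = monomial d 1 ∧ (∑ j, d j) = n ∧ wtLt d w}

/-- `P_5(ω)`: the span of degree-`n` monomials whose weight vector is `≤ w`. -/
def PLe (n : ℕ) (w : List ℕ) : Submodule (ZMod 2) P5 :=
  Submodule.span (ZMod 2)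
    {x : P5 | ∃ d : Fin 5 →₀ ℕ, x = monomial d 1 ∧ (∑ j, d j) = n ∧ (wtLt d w ∨ hasWt d w)}

/-- The monomial `x_1^a x_2^b x_3^c x_4^d x_5^e`. -/
def mon (a b c d e : ℕ) : P5 :=
  X 0 ^ a * X 1 ^ b * X 2 ^ c * X 3 ^ d * X 4 ^ e

/-- The identity, kept as a named constant so that the kernel unfolds nested calls one by one. -/
def tramp (b : Bool) : Bool := b

/-- Clear one column in each block `b`: add `row`, shifted to each set bit of `b &&& Lp`. -/
def clearBlocks (Lp row : ℕ) (bs : List ℕ) : (List ℕ → Bool) → Bool :=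
  List.rec (motive := fun _ => (List ℕ → Bool) → Bool) (fun k => k [])
    (fun b _ ih k => (fun c => Bool.rec
      (tramp (ih fun bs => k (Nat.xor b (Nat.mul c row) :: bs)))
      (tramp (ih fun bs => k (b :: bs))) (Nat.beq c 0)) (Nat.land b Lp)) bs

/-- Drop the zero rows at the low end of a block. -/
def strip (W M n : ℕ) : ℕ → (ℕ → ℕ → Bool) → Bool :=
  Nat.rec (motive := fun _ => ℕ → (ℕ → ℕ → Bool) → Bool) (fun _ _ => false)
    (fun _ ih b k => (fun r => Bool.rec (k b r) (ih (Nat.shiftRight b W) k) (Nat.beq r 0))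
      (Nat.land b M)) n

/-- Gaussian elimination over `F_2` on the rows of width `W` stored in the blocks `bs`, carrying
the blocks `ps` along. It succeeds only if the rank is `n`. -/
def eliminate (W B M L n : ℕ) : List ℕ → List ℕ → (List ℕ → Bool) → Bool :=
  Nat.rec (motive := fun _ => List ℕ → List ℕ → (List ℕ → Bool) → Bool)
    (fun bs ps k => List.rec (k ps) (fun b _ ih => Bool.rec false ih (Nat.beq b 0)) bs)
    (fun _ ih bs ps k => List.rec false
      (fun b bs ih' => Bool.rec
        (strip W M B b fun b r => (fun q => (fun Lp row =>
          clearBlocks Lp row (b :: bs) fun bs =>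
          clearBlocks Lp row ps fun ps => tramp (ih bs ps k)) (Nat.mul L q) (Nat.div r q))
          (Nat.gcd r (Nat.succ M)))
        (tramp ih') (Nat.beq b 0)) bs) n

/-- Pack rows of width `W` into blocks of `B` rows. -/
def packRows (W B M : ℕ) (l : List ℕ) : ℕ → ℕ → List ℕ :=
  List.rec (motive := fun _ => ℕ → ℕ → List ℕ) (fun _ acc => [acc])
    (fun r _ ih j acc => Nat.rec (acc :: ih (Nat.pred B) (Nat.land r M))
      (fun j _ => ih j (Nat.xor (Nat.shiftLeft acc W) (Nat.land r M))) j) l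

/-- The lowest `W` binary digits of `n` as a vector. -/
def bits (W n : ℕ) : Fin W → ZMod 2 := fun j => if n.testBit j then 1 else 0

lemma bits_xor (W a b : ℕ) : bits W (a ^^^ b) = bits W a + bits W b := by
  ext j
  simp only [bits, Nat.testBit_xor, Pi.add_apply]
  cases a.testBit j <;> cases b.testBit j <;> (simp; try decide)

lemma bits_zero (W : ℕ) : bits W 0 = 0 := by
  ext j; simp [bits]

/-- The `i`-th row of a block. -/
def blockRow (W b i : ℕ) : Fin W → ZMod 2 := bits W (b >>> (W * i))

/-- The span of the rows of a list of blocks. -/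
def rowSpan (W : ℕ) (bs : List ℕ) : Submodule (ZMod 2) (Fin W → ZMod 2) :=
  Submodule.span (ZMod 2) {v | ∃ b ∈ bs, ∃ i, v = blockRow W b i}

lemma rowSpan_cons (W b : ℕ) (bs : List ℕ) :
    rowSpan W (b :: bs) = rowSpan W [b] ⊔ rowSpan W bs := by
  rw [rowSpan, rowSpan, rowSpan, ← Submodule.span_union]
  congr 1
  ext v
  simp [or_and_right, exists_or]

lemma rowSpan_singleton_zero (W : ℕ) : rowSpan W [0] = ⊥ := by
  rw [rowSpan, Submodule.span_eq_bot]
  rintro v ⟨b, hb, i, rfl⟩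
  simp only [List.mem_singleton] at hb
  simp [hb, blockRow, bits_zero]

lemma blockRow_shiftRight (W b i : ℕ) : blockRow W (b >>> W) i = blockRow W b (i + 1) := by
  simp only [blockRow, ← Nat.shiftRight_add]
  congr 2; ring

lemma bits_land_mask (W r : ℕ) : bits W (r &&& (2 ^ W - 1)) = bits W r := by
  ext j
  simp [bits, Nat.and_two_pow_sub_one_eq_mod]

lemma blockRow_succ_of_lt {W r : ℕ} (h : r < 2 ^ W) (i : ℕ) : blockRow W r (i + 1) = 0 := by
  have : r >>> (W * (i + 1)) = 0 := by
    rw [Nat.shiftRight_eq_div_pow]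
    exact Nat.div_eq_of_lt (h.trans_le (Nat.pow_le_pow_right two_pos (by nlinarith)))
  rw [blockRow, this, bits_zero]

lemma rowSpan_shiftRight {W b : ℕ} (h : b &&& (2 ^ W - 1) = 0) :
    rowSpan W [b >>> W] = rowSpan W [b] := by
  have h0 : blockRow W b 0 = 0 := by
    rw [blockRow, mul_zero, Nat.shiftRight_zero, ← bits_land_mask, h, bits_zero]
  apply le_antisymm <;> refine Submodule.span_le.2 ?_ <;> rintro v ⟨c, hc, i, rfl⟩ <;>
    obtain rfl := List.mem_singleton.1 hc
  · rw [blockRow_shiftRight]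
    exact Submodule.subset_span ⟨b, by simp, _, rfl⟩
  · cases i with
    | zero => rw [h0]; exact zero_mem _
    | succ i =>
      rw [← blockRow_shiftRight]
      exact Submodule.subset_span ⟨_, by simp, _, rfl⟩

lemma rowSpan_singleton_of_lt {W r : ℕ} (h : r < 2 ^ W) :
    rowSpan W [r] = Submodule.span (ZMod 2) {bits W r} := by
  apply le_antisymm <;> refine Submodule.span_le.2 ?_
  · rintro v ⟨c, hc, i, rfl⟩
    simp only [List.mem_singleton] at hc
    subst hc
    cases i with
    | zero =>
      rw [blockRow, mul_zero, Nat.shiftRight_zero]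
      exact Submodule.subset_span rfl
    | succ i => rw [blockRow_succ_of_lt h]; exact zero_mem _
  · rintro v rfl
    exact Submodule.subset_span ⟨r, by simp, 0, by simp [blockRow]⟩

lemma rowSpan_shiftLeft_xor {W acc r : ℕ} (hr : r < 2 ^ W) :
    rowSpan W [(acc <<< W) ^^^ r] = rowSpan W [acc] ⊔ Submodule.span (ZMod 2) {bits W r} := by
  have h0 : blockRow W ((acc <<< W) ^^^ r) 0 = bits W r := by
    ext j
    have hj : ¬ W ≤ (j : ℕ) := not_le.2 j.2
    simp only [blockRow, bits, mul_zero, Nat.shiftRight_zero, Nat.testBit_xor,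
      Nat.testBit_shiftLeft, ge_iff_le, hj, decide_false, Bool.false_and, Bool.false_xor]
  have h1 (i : ℕ) : blockRow W ((acc <<< W) ^^^ r) (i + 1) = blockRow W acc i := by
    rw [← blockRow_shiftRight, Nat.shiftRight_xor_distrib, Nat.shiftLeft_shiftRight,
      Nat.shiftRight_eq_div_pow r, Nat.div_eq_of_lt hr, Nat.xor_zero]
  apply le_antisymm
  · refine Submodule.span_le.2 ?_
    rintro v ⟨c, hc, i, rfl⟩
    simp only [List.mem_singleton] at hc
    subst hc
    cases i with
    | zero => rw [h0]; exact Submodule.mem_sup_right (Submodule.subset_span rfl)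
    | succ i =>
      rw [h1]; exact Submodule.mem_sup_left (Submodule.subset_span ⟨acc, by simp, i, rfl⟩)
  · refine sup_le (Submodule.span_le.2 ?_) (Submodule.span_le.2 ?_)
    · rintro v ⟨c, hc, i, rfl⟩
      simp only [List.mem_singleton] at hc
      subst hc
      rw [← h1]
      exact Submodule.subset_span ⟨_, by simp, _, rfl⟩
    · rintro v rfl
      rw [← h0]
      exact Submodule.subset_span ⟨_, by simp, _, rfl⟩

lemma packRows_spec {W B : ℕ} (hB : 0 < B) (l : List ℕ) (j acc : ℕ) (hj : j ≤ B)
    (hacc : acc < 2 ^ (W * (B - j))) :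
    (∀ b ∈ packRows W B (2 ^ W - 1) l j acc, b < 2 ^ (W * B)) ∧
      rowSpan W (packRows W B (2 ^ W - 1) l j acc) =
        rowSpan W [acc] ⊔ Submodule.span (ZMod 2) {v | ∃ r ∈ l, v = bits W r} := by
  induction l generalizing j acc with
  | nil =>
    refine ⟨?_, by simp [packRows]⟩
    intro b hb
    obtain rfl : b = acc := by simpa [packRows] using hb
    exact hacc.trans_le (Nat.pow_le_pow_right two_pos (Nat.mul_le_mul_left _ (Nat.sub_le _ _)))
  | cons r l ih =>
    have hlt : r &&& (2 ^ W - 1) < 2 ^ W := by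
      rw [Nat.and_two_pow_sub_one_eq_mod]; exact Nat.mod_lt _ (by positivity)
    have hspan : Submodule.span (ZMod 2) {v | ∃ r' ∈ r :: l, v = bits W r'} =
        Submodule.span (ZMod 2) {bits W (r &&& (2 ^ W - 1))} ⊔
          Submodule.span (ZMod 2) {v | ∃ r ∈ l, v = bits W r} := by
      rw [← Submodule.span_union, bits_land_mask]
      congr 1
      ext v
      simp
    rw [hspan]
    cases j with
    | zero =>
      change (∀ b ∈ acc :: packRows W B (2 ^ W - 1) l (B - 1) (r &&& (2 ^ W - 1)), _) ∧
        rowSpan W (acc :: packRows W B (2 ^ W - 1) l (B - 1) (r &&& (2 ^ W - 1))) = _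
      obtain ⟨h1, h2⟩ := ih (B - 1) (r &&& (2 ^ W - 1)) (Nat.sub_le _ _)
        (by rw [show B - (B - 1) = 1 by omega, mul_one]; exact hlt)
      refine ⟨?_, ?_⟩
      · intro b hb
        rcases List.mem_cons.1 hb with rfl | hb
        · simpa using hacc
        · exact h1 b hb
      · rw [rowSpan_cons, h2, rowSpan_singleton_of_lt hlt]
    | succ j =>
      change (∀ b ∈ packRows W B (2 ^ W - 1) l j ((acc <<< W) ^^^ (r &&& (2 ^ W - 1))), _) ∧
        rowSpan W (packRows W B (2 ^ W - 1) l j ((acc <<< W) ^^^ (r &&& (2 ^ W - 1)))) = _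
      obtain ⟨h1, h2⟩ := ih j ((acc <<< W) ^^^ (r &&& (2 ^ W - 1))) (by omega) (by
        have e : W * (B - j) = W * (B - (j + 1)) + W := by
          rw [show B - j = B - (j + 1) + 1 by omega]; ring
        refine Nat.xor_lt_two_pow ?_ (hlt.trans_le (Nat.pow_le_pow_right two_pos (by omega)))
        rw [e, pow_add, Nat.shiftLeft_eq]
        exact Nat.mul_lt_mul_of_pos_right hacc (by positivity))
      refine ⟨h1, ?_⟩
      rw [h2, rowSpan_shiftLeft_xor hlt, sup_assoc]

/-- The word with `B` digits `1` in base `2 ^ W`. -/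
def ones (W B : ℕ) : ℕ := Nat.div (Nat.pred (Nat.pow 2 (Nat.mul W B))) (Nat.pred (Nat.pow 2 W))

lemma ones_eq {W : ℕ} (hW : 0 < W) (B : ℕ) : ones W B = ∑ i ∈ Finset.range B, 2 ^ (W * i) := by
  have := Nat.geomSum_eq (m := 2 ^ W) (by simpa using Nat.pow_le_pow_right two_pos hW) B
  simp only [← pow_mul] at this
  exact this.symm

lemma land_ones_mul {W p r s b : ℕ} (hp : p < W) (hr : r < 2 ^ W) (hrs : r = 2 ^ p * s) (B : ℕ) :
    (b &&& ((∑ i ∈ Finset.range B, 2 ^ (W * i)) * 2 ^ p)) * s < 2 ^ (W * B) ∧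
    ∀ i < B, ∀ j < W,
      ((b &&& ((∑ i ∈ Finset.range B, 2 ^ (W * i)) * 2 ^ p)) * s).testBit (W * i + j) =
        (b.testBit (W * i + p) && r.testBit j) := by
  induction B with
  | zero => simp
  | succ B ih =>
    have hlt : (∑ i ∈ Finset.range B, 2 ^ (W * i)) * 2 ^ p < 2 ^ (W * B) := by
      clear ih
      induction B with
      | zero => simp
      | succ B ih =>
        rw [Finset.sum_range_succ, add_mul, Nat.mul_succ, pow_add]
        have h1 : 2 ^ p * 2 ≤ 2 ^ W := by
          rw [← pow_succ]; exact Nat.pow_le_pow_right two_pos hp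
        have h2 := Nat.mul_le_mul_left (2 ^ (W * B)) h1
        have h3 := Nat.mul_le_mul_left (2 ^ (W * B)) (Nat.one_le_two_pow (n := p))
        linarith
    have hsplit : (b &&& ((∑ i ∈ Finset.range (B + 1), 2 ^ (W * i)) * 2 ^ p)) * s =
        2 ^ (W * B) * ((b.testBit (W * B + p)).toNat * r) +
          (b &&& ((∑ i ∈ Finset.range B, 2 ^ (W * i)) * 2 ^ p)) * s := by
      set A := (∑ i ∈ Finset.range B, 2 ^ (W * i)) * 2 ^ p with hA
      have e1 : (∑ i ∈ Finset.range (B + 1), 2 ^ (W * i)) * 2 ^ p = 2 ^ (W * B + p) ||| A := by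
        rw [pow_add, ← Nat.two_pow_add_eq_or_of_lt hlt, Finset.sum_range_succ, add_mul, hA]
        ring
      have e2 : b &&& 2 ^ (W * B + p) = 2 ^ (W * B) * ((b.testBit (W * B + p)).toNat * 2 ^ p) := by
        rw [Nat.and_two_pow]; ring
      rw [e1, Nat.and_or_distrib_left, e2,
        ← Nat.two_pow_add_eq_or_of_lt (Nat.and_le_right.trans_lt hlt), hrs]
      ring
    rw [hsplit]
    have hle : (b.testBit (W * B + p)).toNat * r < 2 ^ W := by
      cases b.testBit (W * B + p) <;> simp [hr]
    refine ⟨?_, ?_⟩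
    · rw [Nat.mul_succ, pow_add]
      have := Nat.mul_le_mul_left (2 ^ (W * B)) hle
      rw [Nat.mul_succ] at this
      exact (Nat.add_lt_add_left ih.1 _).trans_le this
    · intro i hi j hj
      rw [Nat.testBit_two_pow_mul_add _ ih.1]
      rcases Nat.lt_succ_iff_lt_or_eq.1 hi with hi | rfl
      · have : W * i + j < W * B := by nlinarith
        rw [if_pos this, ih.2 i hi j hj]
      · rw [if_neg (by omega), Nat.add_sub_cancel_left]
        cases b.testBit (W * i + p) <;> simp

/-- The block `b` with the column of the pivot `p` cleared by means of the row `2 ^ p * s`. -/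
def clearBlock (Lp s b : ℕ) : ℕ := b ^^^ ((b &&& Lp) * s)

lemma clearBlocks_eq (Lp s : ℕ) (bs : List ℕ) (k : List ℕ → Bool) :
    clearBlocks Lp s bs k = k (bs.map (clearBlock Lp s)) := by
  induction bs generalizing k with
  | nil => rfl
  | cons b bs ih =>
    have h : clearBlocks Lp s (b :: bs) k = Bool.rec
        (clearBlocks Lp s bs fun bs => k (clearBlock Lp s b :: bs))
        (clearBlocks Lp s bs fun bs => k (b :: bs)) (Nat.beq (b &&& Lp) 0) := rfl
    rw [h]
    cases hc : Nat.beq (b &&& Lp) 0 with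
    | false => exact ih _
    | true =>
      have : clearBlock Lp s b = b := by simp [clearBlock, Nat.eq_of_beq_eq_true hc]
      rw [List.map_cons, this]
      exact ih _

lemma strip_spec {W : ℕ} (n b : ℕ) (k : ℕ → ℕ → Bool) (h : strip W (2 ^ W - 1) n b k = true) :
    ∃ c, c ≤ b ∧ c &&& (2 ^ W - 1) ≠ 0 ∧ rowSpan W [c] = rowSpan W [b] ∧
      k c (c &&& (2 ^ W - 1)) = true := by
  induction n generalizing b with
  | zero => exact absurd h Bool.false_ne_true
  | succ n ih =>
    have e : strip W (2 ^ W - 1) (n + 1) b k = Bool.rec (k b (b &&& (2 ^ W - 1)))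
      (strip W (2 ^ W - 1) n (b >>> W) k) (Nat.beq (b &&& (2 ^ W - 1)) 0) := rfl
    rw [e] at h
    cases hc : Nat.beq (b &&& (2 ^ W - 1)) 0 with
    | false =>
      rw [hc] at h
      exact ⟨b, le_rfl, Nat.ne_of_beq_eq_false hc, rfl, h⟩
    | true =>
      rw [hc] at h
      obtain ⟨c, h1, h2, h3, h4⟩ := ih _ h
      refine ⟨c, h1.trans ?_, h2, h3.trans (rowSpan_shiftRight (Nat.eq_of_beq_eq_true hc)), h4⟩
      rw [Nat.shiftRight_eq_div_pow]; exact Nat.div_le_self _ _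

lemma exists_pivot {W r : ℕ} (h0 : r ≠ 0) (hr : r < 2 ^ W) :
    ∃ p < W, Nat.gcd r (2 ^ W) = 2 ^ p ∧ r = 2 ^ p * (r / 2 ^ p) ∧ r.testBit p = true := by
  obtain ⟨p, hpW, hp⟩ := (Nat.dvd_prime_pow Nat.prime_two).1 (Nat.gcd_dvd_right r (2 ^ W))
  have hdvd : 2 ^ p ∣ r := hp ▸ Nat.gcd_dvd_left r (2 ^ W)
  have hlt : p < W := by
    have := (Nat.le_of_dvd (Nat.pos_of_ne_zero h0) hdvd).trans_lt hr
    exact (Nat.pow_lt_pow_iff_right (by norm_num)).1 this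
  refine ⟨p, hlt, hp, (Nat.mul_div_cancel' hdvd).symm, ?_⟩
  rw [Nat.testBit_eq_decide_div_mod_eq, decide_eq_true_eq]
  by_contra hne
  have h2 : 2 ∣ r / 2 ^ p := by omega
  have h3 : 2 ^ (p + 1) ∣ r := by
    rw [pow_succ]; exact Nat.mul_dvd_of_dvd_div hdvd h2
  have h4 := Nat.dvd_gcd h3 (pow_dvd_pow 2 hlt)
  rw [hp] at h4
  exact absurd (Nat.le_of_dvd (by positivity) h4)
    (not_le.2 (Nat.pow_lt_pow_right one_lt_two (Nat.lt_succ_self p)))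

lemma finrank_rowSpan_clear {W B r p s b : ℕ} {bs : List ℕ} (hp : p < W) (hr : r < 2 ^ W)
    (hrs : r = 2 ^ p * s) (hbit : r.testBit p = true) (hb : b &&& (2 ^ W - 1) = r)
    (hlt : ∀ c ∈ b :: bs, c < 2 ^ (W * B)) :
    (∀ c ∈ (b :: bs).map (clearBlock (ones W B * 2 ^ p) s), c < 2 ^ (W * B)) ∧
    Module.finrank (ZMod 2) (rowSpan W (b :: bs)) =
      Module.finrank (ZMod 2)
        (rowSpan W ((b :: bs).map (clearBlock (ones W B * 2 ^ p) s))) + 1 := by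
  rw [ones_eq (by omega)]
  set Lp := (∑ i ∈ Finset.range B, 2 ^ (W * i)) * 2 ^ p with hLp
  set v := bits W r with hv
  have hvp : v ⟨p, hp⟩ = 1 := by simp [hv, bits, hbit]
  have hclear (c : ℕ) (hc : c < 2 ^ (W * B)) (i : ℕ) :
      blockRow W (clearBlock Lp s c) i = blockRow W c i + blockRow W c i ⟨p, hp⟩ • v := by
    ext j
    have hspec := land_ones_mul (b := c) hp hr hrs B
    have hbits : (clearBlock Lp s c).testBit (W * i + j) =
        (c.testBit (W * i + j) ^^ (c.testBit (W * i + p) && r.testBit j)) := by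
      rw [clearBlock, Nat.testBit_xor]
      congr 1
      by_cases hi : i < B
      · exact hspec.2 i hi j j.2
      · have hle : W * B ≤ W * i := Nat.mul_le_mul_left _ (not_lt.1 hi)
        rw [Nat.testBit_lt_two_pow (hspec.1.trans_le (Nat.pow_le_pow_right two_pos (by omega))),
          Nat.testBit_lt_two_pow (hc.trans_le (Nat.pow_le_pow_right two_pos (by omega))),
          Bool.false_and]
    simp only [blockRow, bits, Nat.testBit_shiftRight, hbits, Pi.add_apply, Pi.smul_apply, hv,
      smul_eq_mul]
    cases c.testBit (W * i + j) <;> cases c.testBit (W * i + p) <;> cases r.testBit j <;>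
      simp <;> decide
  refine ⟨?_, ?_⟩
  · intro c hc
    obtain ⟨d, hd, rfl⟩ := List.mem_map.1 hc
    exact Nat.xor_lt_two_pow (hlt d hd) (land_ones_mul hp hr hrs B).1
  set S := rowSpan W ((b :: bs).map (clearBlock Lp s)) with hS
  have hvmem : v ∈ rowSpan W (b :: bs) := by
    refine Submodule.subset_span ⟨b, by simp, 0, ?_⟩
    rw [blockRow, mul_zero, Nat.shiftRight_zero, ← bits_land_mask, hb]
  have hker : ∀ w ∈ S, w ⟨p, hp⟩ = 0 := by
    intro w hw
    have : S ≤ LinearMap.ker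
        (LinearMap.proj (R := ZMod 2) (φ := fun _ : Fin W => ZMod 2) ⟨p, hp⟩) := by
      refine Submodule.span_le.2 ?_
      rintro w ⟨c, hc, i, rfl⟩
      obtain ⟨d, hd, rfl⟩ := List.mem_map.1 hc
      rw [hclear d (hlt d hd)]
      simp only [SetLike.mem_coe, LinearMap.mem_ker, LinearMap.proj_apply, Pi.add_apply,
        Pi.smul_apply, hvp, smul_eq_mul, mul_one]
      exact CharTwo.add_self_eq_zero _
    exact this hw
  have hsup : rowSpan W (b :: bs) = S ⊔ Submodule.span (ZMod 2) {v} := by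
    apply le_antisymm
    · refine Submodule.span_le.2 ?_
      rintro w ⟨c, hc, i, rfl⟩
      have h1 : blockRow W c i =
          blockRow W (clearBlock Lp s c) i - blockRow W c i ⟨p, hp⟩ • v := by
        rw [hclear c (hlt c hc)]; simp
      rw [h1]
      exact sub_mem (Submodule.mem_sup_left (Submodule.subset_span
          ⟨_, List.mem_map_of_mem hc, i, rfl⟩))
        (Submodule.mem_sup_right (Submodule.smul_mem _ _ (Submodule.mem_span_singleton_self v)))
    · refine sup_le (Submodule.span_le.2 ?_) ((Submodule.span_singleton_le_iff_mem _ _).2 hvmem)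
      rintro w ⟨c, hc, i, rfl⟩
      obtain ⟨d, hd, rfl⟩ := List.mem_map.1 hc
      rw [hclear d (hlt d hd)]
      exact add_mem (Submodule.subset_span ⟨d, hd, i, rfl⟩) (Submodule.smul_mem _ _ hvmem)
  have hinf : S ⊓ Submodule.span (ZMod 2) {v} = ⊥ := by
    rw [eq_bot_iff]
    rintro w ⟨h1, h2⟩
    obtain ⟨a, rfl⟩ := Submodule.mem_span_singleton.1 h2
    have := hker _ h1
    simp only [Pi.smul_apply, hvp, smul_eq_mul, mul_one] at this
    simp [this]
  have hv0 : v ≠ 0 := fun h => by simp [h] at hvp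
  have := Submodule.finrank_sup_add_finrank_inf_eq S (Submodule.span (ZMod 2) {v})
  rw [hinf, finrank_bot, add_zero, finrank_span_singleton hv0] at this
  rw [hsup, this]

lemma eliminate_spec {W B : ℕ} (n : ℕ) (bs ps : List ℕ) (k : List ℕ → Bool)
    (hlt : ∀ b ∈ bs, b < 2 ^ (W * B))
    (h : eliminate W B (2 ^ W - 1) (ones W B) n bs ps k = true) :
    Module.finrank (ZMod 2) (rowSpan W bs) = n ∧ ∃ qs, k qs = true := by
  induction n generalizing bs ps with
  | zero =>
    induction bs with
    | nil =>
      have h0 : rowSpan W [] = ⊥ := by simp [rowSpan]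
      exact ⟨by rw [h0, finrank_bot], ps, h⟩
    | cons b bs ih =>
      have e : eliminate W B (2 ^ W - 1) (ones W B) 0 (b :: bs) ps k = Bool.rec false
        (eliminate W B (2 ^ W - 1) (ones W B) 0 bs ps k) (Nat.beq b 0) := rfl
      rw [e] at h
      cases hb : Nat.beq b 0 with
      | false => rw [hb] at h; exact absurd h Bool.false_ne_true
      | true =>
        rw [hb] at h
        obtain rfl : b = 0 := Nat.eq_of_beq_eq_true hb
        rw [rowSpan_cons, rowSpan_singleton_zero, bot_sup_eq]
        exact ih (fun c hc => hlt c (List.mem_cons_of_mem _ hc)) h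
  | succ n ihn =>
    induction bs with
    | nil => exact absurd h Bool.false_ne_true
    | cons b bs ih =>
      have e : eliminate W B (2 ^ W - 1) (ones W B) (n + 1) (b :: bs) ps k = Bool.rec
        (strip W (2 ^ W - 1) B b fun b r =>
          clearBlocks (ones W B * Nat.gcd r (2 ^ W - 1 + 1)) (r / Nat.gcd r (2 ^ W - 1 + 1))
            (b :: bs) fun bs =>
          clearBlocks (ones W B * Nat.gcd r (2 ^ W - 1 + 1)) (r / Nat.gcd r (2 ^ W - 1 + 1)) ps
            fun ps => eliminate W B (2 ^ W - 1) (ones W B) n bs ps k)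
        (eliminate W B (2 ^ W - 1) (ones W B) (n + 1) bs ps k) (Nat.beq b 0) := rfl
      rw [e] at h
      cases hb : Nat.beq b 0 with
      | true =>
        rw [hb] at h
        obtain rfl : b = 0 := Nat.eq_of_beq_eq_true hb
        rw [rowSpan_cons, rowSpan_singleton_zero, bot_sup_eq]
        exact ih (fun c hc => hlt c (List.mem_cons_of_mem _ hc)) h
      | false =>
        rw [hb] at h
        obtain ⟨c, hcb, hc0, hspan, hc⟩ := strip_spec _ _ _ h
        simp only [clearBlocks_eq] at hc
        set r := c &&& (2 ^ W - 1) with hrdef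
        have hr : r < 2 ^ W := by
          rw [hrdef, Nat.and_two_pow_sub_one_eq_mod]; exact Nat.mod_lt _ (by positivity)
        obtain ⟨p, hp, hg, hrs, hbit⟩ := exists_pivot hc0 hr
        rw [Nat.sub_add_cancel Nat.one_le_two_pow, hg] at hc
        have hlt' : ∀ d ∈ c :: bs, d < 2 ^ (W * B) := by
          intro d hd
          rcases List.mem_cons.1 hd with rfl | hd
          · exact hcb.trans_lt (hlt b (by simp))
          · exact hlt d (List.mem_cons_of_mem _ hd)
        obtain ⟨h1, h2⟩ := finrank_rowSpan_clear hp hr hrs hbit hrdef.symm hlt'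
        obtain ⟨h3, h4⟩ := ihn _ _ h1 hc
        refine ⟨?_, h4⟩
        rw [rowSpan_cons, ← hspan, ← rowSpan_cons, h2, h3]

/-- A table of numbers indexed by the first four exponents of a monomial of fixed degree. -/
abbrev Tab : Type := List (List (List (List ℕ)))

/-- Exponent vectors. -/
abbrev Exps : Type := ℕ × ℕ × ℕ × ℕ × ℕ

/-- The `n`-th entry of a list. -/
def nth {α : Type} (d : α) (n : ℕ) : List α → α :=
  Nat.rec (motive := fun _ => List α → α) (fun l => List.rec d (fun h _ _ => h) l)
    (fun _ ih l => List.rec d (fun _ t _ => ih t) l) n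

/-- Table lookup. -/
def tget (t : Tab) (a b c e : ℕ) : ℕ := nth 0 e (nth [] c (nth [] b (nth [] a t)))

/-- The sum of the values of `f` on a list, with respect to bitwise addition. -/
def xorSum (f : ℕ → ℕ) (l : List ℕ) : ℕ :=
  List.rec 0 (fun s _ ih => Nat.xor (f s) ih) l

/-- The numbers `s` with `b.choose s` odd, for `b < 10`. -/
def oddBinom (b : ℕ) : List ℕ :=
  nth [] b [[0], [0, 1], [0, 2], [0, 1, 2, 3], [0, 4], [0, 1, 4, 5], [0, 2, 4, 6],
    [0, 1, 2, 3, 4, 5, 6, 7], [0, 8], [0, 1, 8, 9]]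

/-- The sum of the entries of `t` over the monomials of degree `d` in the total square of the
monomial with exponents `z`. -/
def sqVal (t : Tab) (d : ℕ) (z : Exps) : ℕ :=
  xorSum (fun s => (fun t n => xorSum (fun s => (fun t n => xorSum (fun s => (fun t n =>
    xorSum (fun s => (fun v n => xorSum (fun s =>
      Bool.rec 0 v (Nat.beq (Nat.add n (Nat.add z.2.2.2.2 s)) d))
      (oddBinom z.2.2.2.2)) (nth 0 (Nat.add z.2.2.2.1 s) t) (Nat.add n (Nat.add z.2.2.2.1 s)))
      (oddBinom z.2.2.2.1)) (nth [] (Nat.add z.2.2.1 s) t) (Nat.add n (Nat.add z.2.2.1 s)))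
      (oddBinom z.2.2.1)) (nth [] (Nat.add z.2.1 s) t) (Nat.add n (Nat.add z.2.1 s)))
      (oddBinom z.2.1)) (nth [] (Nat.add z.1 s) t) (Nat.add z.1 s))
    (oddBinom z.1)

/-- The exponent vectors of degree `d`, in lexicographic order. -/
def mons (d : ℕ) : List Exps :=
  (List.range (d + 1)).flatMap fun a => (List.range (d - a + 1)).flatMap fun b =>
    (List.range (d - a - b + 1)).flatMap fun c => (List.range (d - a - b - c + 1)).map fun e =>
      (a, b, c, e, d - a - b - c - e)

/-- The exponent vectors of degree less than `n`. -/
def lowMons (n : ℕ) : List Exps := (List.range n).flatMap mons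

lemma mem_mons {d : ℕ} {z : Exps} :
    z ∈ mons d ↔ z.1 + z.2.1 + z.2.2.1 + z.2.2.2.1 + z.2.2.2.2 = d := by
  obtain ⟨a, b, c, e, f⟩ := z
  simp only [mons, List.mem_flatMap, List.mem_map, List.mem_range, Prod.mk.injEq]
  constructor
  · rintro ⟨a', h1, b', h2, c', h3, e', h4, rfl, rfl, rfl, rfl, rfl⟩
    omega
  · rintro rfl
    exact ⟨a, by omega, b, by omega, c, by omega, e, by omega, rfl, rfl, rfl, rfl, by omega⟩

lemma mem_lowMons {n : ℕ} {z : Exps} :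
    z ∈ lowMons n ↔ z.1 + z.2.1 + z.2.2.1 + z.2.2.2.1 + z.2.2.2.2 < n := by
  simp [lowMons, mem_mons]

/-- The monomial with exponents `z`. -/
def toMon (z : Exps) : P5 := mon z.1 z.2.1 z.2.2.1 z.2.2.2.1 z.2.2.2.2

lemma monomial_eq_toMon (e : Fin 5 →₀ ℕ) :
    (monomial e 1 : P5) = toMon (e 0, e 1, e 2, e 3, e 4) := by
  rw [monomial_eq, C_1, one_mul, Finsupp.prod_fintype _ _ (fun _ => pow_zero _),
    Fin.prod_univ_five]
  rfl

lemma toMon_eq_monomial (z : Exps) :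
    toMon z = monomial (Finsupp.equivFunOnFinite.symm
      ![z.1, z.2.1, z.2.2.1, z.2.2.2.1, z.2.2.2.2]) 1 := by
  rw [monomial_eq_toMon]
  rfl

lemma span_toMon : Submodule.span (ZMod 2) (Set.range toMon) = ⊤ := by
  rw [eq_top_iff, ← (basisMonomials (Fin 5) (ZMod 2)).span_eq]
  refine Submodule.span_mono ?_
  rintro _ ⟨e, rfl⟩
  exact ⟨_, (monomial_eq_toMon e).symm.trans (congrFun (coe_basisMonomials _ _) e).symm⟩

lemma isHomogeneous_toMon (z : Exps) :
    (toMon z).IsHomogeneous (z.1 + z.2.1 + z.2.2.1 + z.2.2.2.1 + z.2.2.2.2) := by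
  have h (i : Fin 5) (n : ℕ) : (X i ^ n : P5).IsHomogeneous n := by
    simpa using (isHomogeneous_X (ZMod 2) i).pow n
  exact ((((h 0 _).mul (h 1 _)).mul (h 2 _)).mul (h 3 _)).mul (h 4 _)

lemma homogeneousSubmodule_eq_span (d : ℕ) : homogeneousSubmodule (Fin 5) (ZMod 2) d =
    Submodule.span (ZMod 2) {f | ∃ z ∈ mons d, f = toMon z} := by
  apply le_antisymm
  · intro f hf
    have hc : f = homogeneousComponent d f := by
      rw [homogeneousComponent_of_mem hf, if_pos rfl]
    have key : ∀ g : P5, homogeneousComponent d g ∈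
        Submodule.span (ZMod 2) {f | ∃ z ∈ mons d, f = toMon z} := by
      intro g
      have hg : g ∈ Submodule.span (ZMod 2) (Set.range toMon) := by
        rw [span_toMon]; trivial
      induction hg using Submodule.span_induction with
      | mem g hg =>
        obtain ⟨z, rfl⟩ := hg
        rw [homogeneousComponent_of_mem (isHomogeneous_toMon z)]
        split_ifs with h
        · exact Submodule.subset_span ⟨z, mem_mons.2 h.symm, rfl⟩
        · exact zero_mem _
      | zero => rw [map_zero]; exact zero_mem _
      | add g h _ _ hg hh => rw [map_add]; exact add_mem hg hh
      | smul a g _ hg => rw [map_smul]; exact Submodule.smul_mem _ _ hg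
    rw [hc]; exact key f
  · refine Submodule.span_le.2 ?_
    rintro f ⟨z, hz, rfl⟩
    exact (mem_mons.1 hz) ▸ isHomogeneous_toMon z

lemma finrank_homogeneousSubmodule_le (d : ℕ) :
    Module.finrank (ZMod 2) (homogeneousSubmodule (Fin 5) (ZMod 2) d) ≤ (mons d).length := by
  have : {f | ∃ z ∈ mons d, f = toMon z} = (((mons d).map toMon).toFinset : Set P5) := by
    ext f; simp [eq_comm]
  rw [homogeneousSubmodule_eq_span, this]
  refine (finrank_span_finset_le_card _).trans ((List.toFinset_card_le _).trans ?_)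
  simp

/-- The linear map reading off the entries of a table on monomials of degree `d`. -/
def lin (W : ℕ) (t : Tab) (d : ℕ) : P5 →ₗ[ZMod 2] (Fin W → ZMod 2) :=
  (basisMonomials (Fin 5) (ZMod 2)).constr (ZMod 2) fun e =>
    if e 0 + e 1 + e 2 + e 3 + e 4 = d then bits W (tget t (e 0) (e 1) (e 2) (e 3)) else 0

lemma lin_toMon (W : ℕ) (t : Tab) (d : ℕ) (z : Exps) : lin W t d (toMon z) =
    if z.1 + z.2.1 + z.2.2.1 + z.2.2.2.1 + z.2.2.2.2 = d then
      bits W (tget t z.1 z.2.1 z.2.2.1 z.2.2.2.1) else 0 := by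
  rw [toMon_eq_monomial, ← congrFun (coe_basisMonomials (Fin 5) (ZMod 2)), lin,
    Module.Basis.constr_basis]
  rfl

lemma ext_toMon {M : Type*} [AddCommGroup M] [Module (ZMod 2) M] {f g : P5 →ₗ[ZMod 2] M}
    (h : ∀ z, f (toMon z) = g (toMon z)) : f = g :=
  LinearMap.ext_on_range span_toMon h

lemma lin_homogeneousComponent (W : ℕ) (t : Tab) (d : ℕ) (f : P5) :
    lin W t d (homogeneousComponent d f) = lin W t d f := by
  have : lin W t d ∘ₗ homogeneousComponent d = lin W t d := by
    refine ext_toMon fun z => ?_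
    rw [LinearMap.comp_apply, homogeneousComponent_of_mem (isHomogeneous_toMon z)]
    split_ifs with h
    · rfl
    · rw [map_zero, lin_toMon, if_neg (Ne.symm h)]
  exact LinearMap.congr_fun this f

lemma bits_xorSum (W : ℕ) (f : ℕ → ℕ) (l : List ℕ) :
    bits W (xorSum f l) = (l.map fun s => bits W (f s)).sum := by
  induction l with
  | nil => exact bits_zero W
  | cons s l ih =>
    rw [List.map_cons, List.sum_cons, ← ih, ← bits_xor]
    rfl

lemma bits_boolRec (W v n d : ℕ) :
    bits W (Bool.rec 0 v (Nat.beq n d)) = if n = d then bits W v else 0 := by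
  split_ifs with h
  · subst h; rw [Nat.beq_refl]
  · cases hb : Nat.beq n d with
    | false => exact bits_zero W
    | true => exact absurd (Nat.eq_of_beq_eq_true hb) h

lemma add_sq_pow_eq_sum {R : Type*} [CommRing R] [CharP R 2] (x : R) {b : ℕ} (hb : b < 10) :
    (x + x ^ 2) ^ b = ((oddBinom b).map fun s => x ^ (b + s)).sum := by
  have h2 : (2 : R) = 0 := CharTwo.two_eq_zero
  interval_cases b
  · rw [show oddBinom 0 = [0] from rfl]
    simp only [List.map_cons, List.map_nil, List.sum_cons, List.sum_nil]
    linear_combination (0) * h2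
  · rw [show oddBinom 1 = [0, 1] from rfl]
    simp only [List.map_cons, List.map_nil, List.sum_cons, List.sum_nil]
    linear_combination (0) * h2
  · rw [show oddBinom 2 = [0, 2] from rfl]
    simp only [List.map_cons, List.map_nil, List.sum_cons, List.sum_nil]
    linear_combination (1 * x ^ 3) * h2
  · rw [show oddBinom 3 = [0, 1, 2, 3] from rfl]
    simp only [List.map_cons, List.map_nil, List.sum_cons, List.sum_nil]
    linear_combination (1 * x ^ 4 + 1 * x ^ 5) * h2
  · rw [show oddBinom 4 = [0, 4] from rfl]
    simp only [List.map_cons, List.map_nil, List.sum_cons, List.sum_nil]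
    linear_combination (2 * x ^ 5 + 3 * x ^ 6 + 2 * x ^ 7) * h2
  · rw [show oddBinom 5 = [0, 1, 4, 5] from rfl]
    simp only [List.map_cons, List.map_nil, List.sum_cons, List.sum_nil]
    linear_combination (2 * x ^ 6 + 5 * x ^ 7 + 5 * x ^ 8 + 2 * x ^ 9) * h2
  · rw [show oddBinom 6 = [0, 2, 4, 6] from rfl]
    simp only [List.map_cons, List.map_nil, List.sum_cons, List.sum_nil]
    linear_combination (3 * x ^ 7 + 7 * x ^ 8 + 10 * x ^ 9 + 7 * x ^ 10 + 3 * x ^ 11) * h2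
  · rw [show oddBinom 7 = [0, 1, 2, 3, 4, 5, 6, 7] from rfl]
    simp only [List.map_cons, List.map_nil, List.sum_cons, List.sum_nil]
    linear_combination (3 * x ^ 8 + 10 * x ^ 9 + 17 * x ^ 10 + 17 * x ^ 11 +
      10 * x ^ 12 + 3 * x ^ 13) * h2
  · rw [show oddBinom 8 = [0, 8] from rfl]
    simp only [List.map_cons, List.map_nil, List.sum_cons, List.sum_nil]
    linear_combination (4 * x ^ 9 + 14 * x ^ 10 + 28 * x ^ 11 + 35 * x ^ 12 +
      28 * x ^ 13 + 14 * x ^ 14 + 4 * x ^ 15) * h2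
  · rw [show oddBinom 9 = [0, 1, 8, 9] from rfl]
    simp only [List.map_cons, List.map_nil, List.sum_cons, List.sum_nil]
    linear_combination (4 * x ^ 10 + 18 * x ^ 11 + 42 * x ^ 12 + 63 * x ^ 13 +
      63 * x ^ 14 + 42 * x ^ 15 + 18 * x ^ 16 + 4 * x ^ 17) * h2

lemma Sq_toMon (z : Exps) : Sq (toMon z) = (X 0 + X 0 ^ 2) ^ z.1 * (X 1 + X 1 ^ 2) ^ z.2.1 *
    (X 2 + X 2 ^ 2) ^ z.2.2.1 * (X 3 + X 3 ^ 2) ^ z.2.2.2.1 * (X 4 + X 4 ^ 2) ^ z.2.2.2.2 := by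
  simp [toMon, mon, Sq]

lemma lin_Sq_toMon (W : ℕ) (t : Tab) (d : ℕ) {z : Exps} (hz : z ∈ lowMons 10) :
    lin W t d (Sq (toMon z)) = bits W (sqVal t d z) := by
  rw [mem_lowMons] at hz
  rw [Sq_toMon, add_sq_pow_eq_sum _ (show z.1 < 10 by omega),
    add_sq_pow_eq_sum _ (show z.2.1 < 10 by omega),
    add_sq_pow_eq_sum _ (show z.2.2.1 < 10 by omega),
    add_sq_pow_eq_sum _ (show z.2.2.2.1 < 10 by omega),
    add_sq_pow_eq_sum _ (show z.2.2.2.2 < 10 by omega)]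
  simp only [mul_assoc]
  simp only [← List.sum_map_mul_right]
  simp only [← List.sum_map_mul_left, map_list_sum, List.map_map, Function.comp_def,
    sqVal, bits_xorSum, bits_boolRec]
  refine congrArg List.sum (List.map_congr_left fun s₀ _ => congrArg List.sum
    (List.map_congr_left fun s₁ _ => congrArg List.sum (List.map_congr_left fun s₂ _ =>
      congrArg List.sum (List.map_congr_left fun s₃ _ => congrArg List.sum
        (List.map_congr_left fun s₄ _ => ?_)))))
  have := lin_toMon W t d (z.1 + s₀, z.2.1 + s₁, z.2.2.1 + s₂, z.2.2.2.1 + s₃, z.2.2.2.2 + s₄)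
  simp only [toMon, mon, mul_assoc] at this
  exact this

lemma ext_monomial {M : Type*} [AddCommGroup M] [Module (ZMod 2) M] {f g : P5 →ₗ[ZMod 2] M}
    (h : ∀ e, f (monomial e 1) = g (monomial e 1)) : f = g :=
  (basisMonomials (Fin 5) (ZMod 2)).ext fun e => by
    simpa only [coe_basisMonomials] using h e

lemma isHomogeneous_monomial_one (e : Fin 5 →₀ ℕ) :
    (monomial e 1 : P5).IsHomogeneous e.degree :=
  isHomogeneous_monomial _ rfl

lemma homogeneousComponent_of_isHomogeneous {f : P5} {m : ℕ} (hf : f.IsHomogeneous m) (n : ℕ) :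
    homogeneousComponent n f = if n = m then f else 0 :=
  homogeneousComponent_of_mem hf

lemma homogeneousComponent_mul_of_lt {f : P5} {m n : ℕ} (hf : f.IsHomogeneous m) (r : P5)
    (h : n < m) : homogeneousComponent n (f * r) = 0 := by
  conv_lhs => rw [← sum_homogeneousComponent r, Finset.mul_sum, map_sum]
  refine Finset.sum_eq_zero fun j _ => ?_
  rw [homogeneousComponent_of_isHomogeneous (hf.mul (homogeneousComponent_isHomogeneous j r)),
    if_neg (by omega)]

lemma homogeneousComponent_add_mul {f : P5} {m : ℕ} (hf : f.IsHomogeneous m) (r : P5) (j : ℕ) :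
    homogeneousComponent (m + j) (f * r) = f * homogeneousComponent j r := by
  conv_lhs => rw [← sum_homogeneousComponent r, Finset.mul_sum, map_sum]
  have h (i : ℕ) : homogeneousComponent (m + j) (f * homogeneousComponent i r) =
      if j = i then f * homogeneousComponent j r else 0 := by
    rw [homogeneousComponent_of_isHomogeneous (hf.mul (homogeneousComponent_isHomogeneous i r))]
    by_cases hij : j = i
    · subst hij; simp
    · rw [if_neg hij, if_neg (by omega)]
  simp only [h, Finset.sum_ite_eq, Finset.mem_range]
  split_ifs with hj
  · rfl
  · rw [homogeneousComponent_eq_zero _ _ (by omega), mul_zero]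

lemma Sq_monomial (e : Fin 5 →₀ ℕ) :
    Sq (monomial e 1) = monomial e 1 * ∏ i, (1 + X i) ^ e i := by
  rw [monomial_eq, Finsupp.prod_fintype _ _ (fun _ => pow_zero _), C_1, one_mul, map_prod,
    ← Finset.prod_mul_distrib]
  refine Finset.prod_congr rfl fun i _ => ?_
  rw [map_pow, ← mul_pow, Sq, aeval_X]
  ring

lemma homogeneousComponent_Sq_of_lt {f : P5} {m n : ℕ} (hf : f.IsHomogeneous m) (h : n < m) :
    homogeneousComponent n (Sq f) = 0 := by
  have key : homogeneousComponent n ∘ₗ Sq.toLinearMap ∘ₗ homogeneousComponent m =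
      (0 : P5 →ₗ[ZMod 2] P5) := by
    refine ext_monomial fun e => ?_
    simp only [LinearMap.comp_apply, AlgHom.toLinearMap_apply, LinearMap.zero_apply,
      homogeneousComponent_of_isHomogeneous (isHomogeneous_monomial_one e)]
    split_ifs with he
    · rw [Sq_monomial]
      exact homogeneousComponent_mul_of_lt (isHomogeneous_monomial_one e) _ (he ▸ h)
    · simp
  have := LinearMap.congr_fun key f
  simpa [homogeneousComponent_of_isHomogeneous hf] using this

lemma homogeneousComponent_Sq_self {f : P5} {m : ℕ} (hf : f.IsHomogeneous m) :
    homogeneousComponent m (Sq f) = f := by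
  have key : homogeneousComponent m ∘ₗ Sq.toLinearMap ∘ₗ homogeneousComponent m =
      (homogeneousComponent m : P5 →ₗ[ZMod 2] P5) := by
    refine ext_monomial fun e => ?_
    simp only [LinearMap.comp_apply, AlgHom.toLinearMap_apply,
      homogeneousComponent_of_isHomogeneous (isHomogeneous_monomial_one e)]
    split_ifs with he
    · rw [Sq_monomial, he]
      refine (homogeneousComponent_add_mul (isHomogeneous_monomial_one e) _ 0).trans ?_
      rw [homogeneousComponent_zero, ← constantCoeff_eq, map_prod]
      simp
    · simp
  have := LinearMap.congr_fun key f
  simpa [homogeneousComponent_of_isHomogeneous hf] using this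

/-- Polynomials whose homogeneous components have degree less than `n`. -/
def degLT (n : ℕ) : Submodule (ZMod 2) P5 where
  carrier := {f | ∀ i, n ≤ i → homogeneousComponent i f = 0}
  add_mem' hf hg i hi := by rw [map_add, hf i hi, hg i hi, add_zero]
  zero_mem' i _ := map_zero _
  smul_mem' a f hf i hi := by rw [map_smul, hf i hi, smul_zero]

lemma mem_degLT_of_isHomogeneous {f : P5} {m n : ℕ} (hf : f.IsHomogeneous m) (h : m < n) :
    f ∈ degLT n := fun i hi => by
  rw [homogeneousComponent_of_isHomogeneous hf, if_neg (by omega)]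

lemma degLT_mul_left {f g : P5} {m n : ℕ} (hf : f.IsHomogeneous m) (hg : g ∈ degLT n) :
    f * g ∈ degLT (m + n) := fun i hi => by
  obtain ⟨j, rfl⟩ := Nat.exists_eq_add_of_le (le_trans (Nat.le_add_right m n) hi)
  rw [homogeneousComponent_add_mul hf, hg j (by omega), mul_zero]

lemma eq_sum_of_mem_degLT {f : P5} {n : ℕ} (hf : f ∈ degLT n) :
    f = ∑ i ∈ Finset.range n, homogeneousComponent i f := by
  conv_lhs => rw [← sum_homogeneousComponent f]
  have h1 : ∑ i ∈ Finset.range (max n (f.totalDegree + 1)), homogeneousComponent i f =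
      ∑ i ∈ Finset.range (f.totalDegree + 1), homogeneousComponent i f := by
    refine (Finset.sum_subset (Finset.range_subset_range.2 (le_max_right _ _)) ?_).symm
    intro i _ hi
    exact homogeneousComponent_eq_zero _ _ (by simpa using hi)
  rw [← h1]
  refine (Finset.sum_subset (Finset.range_subset_range.2 (le_max_left _ _)) ?_).symm
  intro i _ hi
  exact hf i (by simpa using hi)

lemma degLT_mono {m n : ℕ} (h : m ≤ n) : degLT m ≤ degLT n := fun _ hf i hi => hf i (h.trans hi)

lemma degLT_mul {f g : P5} {m n : ℕ} (hf : f ∈ degLT m) (hg : g ∈ degLT n) :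
    f * g ∈ degLT (m + n) := by
  rw [eq_sum_of_mem_degLT hf, Finset.sum_mul]
  refine sum_mem fun i hi => ?_
  rw [Finset.mem_range] at hi
  exact degLT_mono (by omega) (degLT_mul_left (homogeneousComponent_isHomogeneous i f) hg)

/-- Squaring as a linear map. -/
def sqMap : P5 →ₗ[ZMod 2] P5 where
  toFun f := f ^ 2
  map_add' f g := CharTwo.add_sq f g
  map_smul' a f := by
    rw [smul_pow, show a ^ 2 = a by revert a; decide]
    rfl

lemma Sq_sub_sq_X_pow (i : Fin 5) (n : ℕ) :
    Sq (X i ^ n) - (X i ^ n) ^ 2 ∈ degLT (2 * n) := by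
  induction n with
  | zero => simp
  | succ n ih =>
    have e : Sq (X i ^ (n + 1)) - (X i ^ (n + 1)) ^ 2 =
        X i ^ 2 * (Sq (X i ^ n) - (X i ^ n) ^ 2) + X i * (X i ^ (2 * n)) +
          X i * (Sq (X i ^ n) - (X i ^ n) ^ 2) := by
      rw [pow_succ, map_mul, show Sq (X i) = X i + X i ^ 2 by rw [Sq, aeval_X]]
      ring
    rw [e]
    have hX := isHomogeneous_X (ZMod 2) i
    have h2 : (X i ^ 2 : P5).IsHomogeneous 2 := by simpa using hX.pow 2
    have h3 : (X i * X i ^ (2 * n) : P5).IsHomogeneous (1 + 2 * n) := by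
      simpa using hX.mul (hX.pow (2 * n))
    refine add_mem (add_mem ?_ ?_) ?_
    · exact degLT_mono (by omega) (degLT_mul_left h2 ih)
    · exact mem_degLT_of_isHomogeneous h3 (by omega)
    · exact degLT_mono (by omega) (degLT_mul_left hX ih)

lemma Sq_sub_sq_mul {f g : P5} {m n : ℕ} (hf : f.IsHomogeneous m) (hg : g.IsHomogeneous n)
    (hf' : Sq f - f ^ 2 ∈ degLT (2 * m)) (hg' : Sq g - g ^ 2 ∈ degLT (2 * n)) :
    Sq (f * g) - (f * g) ^ 2 ∈ degLT (2 * (m + n)) := by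
  have e : Sq (f * g) - (f * g) ^ 2 = (Sq f - f ^ 2) * (Sq g - g ^ 2) +
      f ^ 2 * (Sq g - g ^ 2) + g ^ 2 * (Sq f - f ^ 2) := by
    rw [map_mul]; ring
  have h1 : (f ^ 2).IsHomogeneous (2 * m) := by simpa [mul_comm] using hf.pow 2
  have h2 : (g ^ 2).IsHomogeneous (2 * n) := by simpa [mul_comm] using hg.pow 2
  rw [e, mul_add]
  refine add_mem (add_mem (degLT_mul hf' hg') (degLT_mul_left h1 hg')) ?_
  rw [add_comm (2 * m)]
  exact degLT_mul_left h2 hf'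

lemma homogeneousComponent_Sq_two_mul {f : P5} {m : ℕ} (hf : f.IsHomogeneous m) :
    homogeneousComponent (2 * m) (Sq f) = f ^ 2 := by
  have hmon (e : Fin 5 →₀ ℕ) : Sq (monomial e 1) - (monomial e 1) ^ 2 ∈ degLT (2 * e.degree) := by
    have h (s : Finset (Fin 5)) : (∏ i ∈ s, X i ^ e i : P5).IsHomogeneous (∑ i ∈ s, e i) ∧
        Sq (∏ i ∈ s, X i ^ e i) - (∏ i ∈ s, X i ^ e i) ^ 2 ∈ degLT (2 * ∑ i ∈ s, e i) := by
      have hX (i : Fin 5) : (X i ^ e i : P5).IsHomogeneous (e i) := by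
        simpa using (isHomogeneous_X (ZMod 2) i).pow (e i)
      induction s using Finset.induction_on with
      | empty => simp [isHomogeneous_one]
      | insert i s hi ih =>
        rw [Finset.prod_insert hi, Finset.sum_insert hi]
        exact ⟨(hX i).mul ih.1, Sq_sub_sq_mul (hX i) ih.1 (Sq_sub_sq_X_pow i _) ih.2⟩
    have := (h Finset.univ).2
    rwa [← Finsupp.degree_eq_sum, ← Finsupp.prod_fintype e (fun i n => (X i ^ n : P5))
      (fun _ => pow_zero _), ← one_mul (e.prod _), ← C_1, ← monomial_eq] at this
  have key : homogeneousComponent (2 * m) ∘ₗ Sq.toLinearMap ∘ₗ homogeneousComponent m =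
      sqMap ∘ₗ (homogeneousComponent m : P5 →ₗ[ZMod 2] P5) := by
    refine ext_monomial fun e => ?_
    simp only [LinearMap.comp_apply, AlgHom.toLinearMap_apply,
      homogeneousComponent_of_isHomogeneous (isHomogeneous_monomial_one e)]
    split_ifs with he
    · have h1 := hmon e _ (le_refl _)
      have h2 : ((monomial e 1 : P5) ^ 2).IsHomogeneous (2 * e.degree) := by
        simpa [mul_comm] using (isHomogeneous_monomial_one e).pow 2
      rw [map_sub, homogeneousComponent_of_isHomogeneous h2, if_pos rfl, sub_eq_zero] at h1
      rw [he, h1]; rfl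
    · simp
  have := LinearMap.congr_fun key f
  simp only [LinearMap.comp_apply, homogeneousComponent_of_isHomogeneous hf, if_pos] at this
  exact this

lemma homogeneousComponent_Sq_mem_hitSpan {g : P5} {n : ℕ} (hg : homogeneousComponent n g = 0) :
    homogeneousComponent n (Sq g) ∈ hitSpan n := by
  have e : homogeneousComponent n (Sq g) = ∑ i ∈ Finset.range (g.totalDegree + 1),
      homogeneousComponent n (Sq (homogeneousComponent i g)) := by
    conv_lhs => rw [← sum_homogeneousComponent g, map_sum, map_sum]
  rw [e]
  refine sum_mem fun i _ => ?_
  rcases lt_trichotomy i n with h | rfl | h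
  · exact Submodule.subset_span ⟨homogeneousComponent i g,
      mem_degLT_of_isHomogeneous (homogeneousComponent_isHomogeneous i g) h, rfl⟩
  · rw [hg, map_zero, map_zero]; exact zero_mem _
  · rw [homogeneousComponent_Sq_of_lt (homogeneousComponent_isHomogeneous i g) h]
    exact zero_mem _

lemma hitSpan_le (n : ℕ) : hitSpan n ≤ homogeneousSubmodule (Fin 5) (ZMod 2) n := by
  refine Submodule.span_le.2 ?_
  rintro f ⟨g, _, rfl⟩
  exact homogeneousComponent_isHomogeneous n _

lemma homogeneousSubmodule_eq_span_monomial (d : ℕ) : homogeneousSubmodule (Fin 5) (ZMod 2) d =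
    Submodule.span (ZMod 2) {f | ∃ e : Fin 5 →₀ ℕ, e.degree = d ∧ f = monomial e 1} := by
  apply le_antisymm
  · rw [homogeneousSubmodule_eq_span]
    refine Submodule.span_mono ?_
    rintro f ⟨z, hz, rfl⟩
    refine ⟨_, ?_, toMon_eq_monomial z⟩
    rw [← mem_mons.1 hz, Finsupp.degree_eq_sum, Fin.sum_univ_five]
    rfl
  · refine Submodule.span_le.2 ?_
    rintro f ⟨e, rfl, rfl⟩
    exact isHomogeneous_monomial_one e

/-- The hit polynomials are spanned by those coming from monomials. -/
lemma hitSpan_eq_span (n : ℕ) : hitSpan n = Submodule.span (ZMod 2)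
    {f | ∃ e : Fin 5 →₀ ℕ, e.degree < n ∧ f = homogeneousComponent n (Sq (monomial e 1))} := by
  apply le_antisymm
  · refine Submodule.span_le.2 ?_
    rintro f ⟨g, hg, rfl⟩
    rw [eq_sum_of_mem_degLT hg, map_sum, map_sum]
    refine sum_mem fun i hi => ?_
    have hmem : homogeneousComponent i g ∈ Submodule.span (ZMod 2)
        {f | ∃ e : Fin 5 →₀ ℕ, e.degree = i ∧ f = monomial e 1} := by
      rw [← homogeneousSubmodule_eq_span_monomial]
      exact homogeneousComponent_isHomogeneous i g
    have := Submodule.mem_map_of_mem (f := homogeneousComponent n ∘ₗ Sq.toLinearMap) hmem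
    rw [Submodule.map_span] at this
    refine Submodule.span_mono ?_ this
    rintro _ ⟨_, ⟨e, he, rfl⟩, rfl⟩
    exact ⟨e, he ▸ Finset.mem_range.1 hi, rfl⟩
  · refine Submodule.span_le.2 ?_
    rintro f ⟨e, he, rfl⟩
    exact Submodule.subset_span ⟨_,
      mem_degLT_of_isHomogeneous (isHomogeneous_monomial_one e) he, rfl⟩

/-- The square-free monomial supported on `K`. -/
def sqfree (K : Finset (Fin 5)) : P5 := ∏ i ∈ K, X i

lemma isHomogeneous_sqfree (K : Finset (Fin 5)) : (sqfree K).IsHomogeneous K.card := by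
  simpa [sqfree] using IsHomogeneous.prod K (fun i => (X i : P5)) (fun _ => 1)
    fun i _ => isHomogeneous_X (ZMod 2) i

/-- The set of variables with odd exponent. -/
def oddSupp (e : Fin 5 →₀ ℕ) : Finset (Fin 5) := Finset.univ.filter fun i => e i % 2 = 1

/-- The exponents divided by two, rounded down. -/
def half (e : Fin 5 →₀ ℕ) : Fin 5 →₀ ℕ := e.mapRange (· / 2) (Nat.zero_div 2)

/-- The coefficient `z` of `f` in its expansion as a sum of terms `sqfree K * z ^ 2`. -/
def sqCoeff (K : Finset (Fin 5)) : P5 →ₗ[ZMod 2] P5 :=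
  (basisMonomials (Fin 5) (ZMod 2)).constr (ZMod 2) fun e =>
    if oddSupp e = K then monomial (half e) 1 else 0

lemma sqCoeff_apply_monomial (K : Finset (Fin 5)) (e : Fin 5 →₀ ℕ) :
    sqCoeff K (monomial e 1) = if oddSupp e = K then monomial (half e) 1 else 0 := by
  have h := (basisMonomials (Fin 5) (ZMod 2)).constr_basis (ZMod 2)
    (fun e => if oddSupp e = K then (monomial (half e) 1 : P5) else 0) e
  rwa [coe_basisMonomials] at h

/-- The map `z ↦ sqfree K * z ^ 2`. -/
def sqMul (K : Finset (Fin 5)) : P5 →ₗ[ZMod 2] P5 := LinearMap.mulLeft (ZMod 2) (sqfree K) ∘ₗ sqMap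

lemma sqMul_apply (K : Finset (Fin 5)) (z : P5) : sqMul K z = sqfree K * z ^ 2 := rfl

lemma sqMul_monomial (K : Finset (Fin 5)) (m : Fin 5 →₀ ℕ) : sqMul K (monomial m 1) =
    monomial (Finsupp.equivFunOnFinite.symm fun i => (if i ∈ K then 1 else 0) + 2 * m i) 1 := by
  rw [sqMul_apply, monomial_eq, monomial_eq, Finsupp.prod_fintype _ _ fun _ => pow_zero _,
    Finsupp.prod_fintype _ _ fun _ => pow_zero _, C_1, one_mul, one_mul, ← Finset.prod_pow]
  simp only [Finsupp.equivFunOnFinite_symm_apply_apply, pow_add, Finset.prod_mul_distrib,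
    pow_ite, pow_one, pow_zero, Finset.prod_ite_mem, Finset.univ_inter, sqfree, ← pow_mul,
    mul_comm]

lemma sqCoeff_sqMul (K J : Finset (Fin 5)) (z : P5) :
    sqCoeff J (sqMul K z) = if J = K then z else 0 := by
  have key : sqCoeff J ∘ₗ sqMul K = if J = K then LinearMap.id else 0 := by
    refine ext_monomial fun m => ?_
    rw [LinearMap.comp_apply, sqMul_monomial, sqCoeff_apply_monomial]
    have h1 : oddSupp (Finsupp.equivFunOnFinite.symm
        fun i => (if i ∈ K then 1 else 0) + 2 * m i) = K := by
      ext i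
      simp only [oddSupp, Finset.mem_filter, Finset.mem_univ, true_and,
        Finsupp.equivFunOnFinite_symm_apply_apply]
      split_ifs with h <;> simp [h]
    have h2 : half (Finsupp.equivFunOnFinite.symm
        fun i => (if i ∈ K then 1 else 0) + 2 * m i) = m := by
      ext i
      simp only [half, Finsupp.mapRange_apply, Finsupp.equivFunOnFinite_symm_apply_apply]
      split_ifs <;> omega
    rw [h1, h2]
    by_cases h : J = K
    · simp [h]
    · simp [h, Ne.symm h]
  rw [← LinearMap.comp_apply, key]
  split_ifs <;> rfl

lemma sqMul_half (e : Fin 5 →₀ ℕ) : sqMul (oddSupp e) (monomial (half e) 1) = monomial e 1 := by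
  rw [sqMul_monomial]
  congr 2
  ext i
  simp only [half, oddSupp, Finsupp.mapRange_apply, Finsupp.equivFunOnFinite_symm_apply_apply,
    Finset.mem_filter, Finset.mem_univ, true_and]
  split_ifs <;> omega

lemma sum_sqMul_sqCoeff (f : P5) : ∑ K, sqMul K (sqCoeff K f) = f := by
  have key : ∑ K, sqMul K ∘ₗ sqCoeff K = LinearMap.id := by
    refine ext_monomial fun e => ?_
    simp only [LinearMap.sum_apply, LinearMap.comp_apply, sqCoeff_apply_monomial]
    rw [Finset.sum_eq_single (oddSupp e)]
    · rw [if_pos rfl, sqMul_half]; rfl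
    · intro K _ h
      rw [if_neg h.symm, map_zero]
    · simp
  simpa only [LinearMap.sum_apply, LinearMap.comp_apply, LinearMap.id_apply] using
    LinearMap.congr_fun key f

lemma isHomogeneous_sqMul (K : Finset (Fin 5)) {z : P5} {m : ℕ} (hz : z.IsHomogeneous m) :
    (sqMul K z).IsHomogeneous (K.card + 2 * m) := by
  rw [sqMul_apply, mul_comm 2]
  exact (isHomogeneous_sqfree K).mul (hz.pow 2)

lemma degree_eq (e : Fin 5 →₀ ℕ) : e.degree = (oddSupp e).card + 2 * (half e).degree := by
  have h := isHomogeneous_sqMul (oddSupp e) (isHomogeneous_monomial_one (half e))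
  rw [sqMul_half] at h
  exact (isHomogeneous_monomial_one e).inj_right h (by simp)

lemma sqCoeff_homogeneousComponent (K : Finset (Fin 5)) (m : ℕ) (f : P5) :
    sqCoeff K (homogeneousComponent (K.card + 2 * m) f) = homogeneousComponent m (sqCoeff K f) := by
  have key : sqCoeff K ∘ₗ homogeneousComponent (K.card + 2 * m) =
      homogeneousComponent m ∘ₗ sqCoeff K := by
    refine ext_monomial fun e => ?_
    rw [LinearMap.comp_apply, LinearMap.comp_apply, sqCoeff_apply_monomial,
      homogeneousComponent_of_isHomogeneous (isHomogeneous_monomial_one e)]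
    by_cases h : oddSupp e = K
    · subst h
      rw [if_pos rfl, homogeneousComponent_of_isHomogeneous (isHomogeneous_monomial_one _),
        degree_eq e]
      by_cases h : m = (half e).degree
      · rw [if_pos (by omega), if_pos h, sqCoeff_apply_monomial, if_pos rfl]
      · rw [if_neg (by omega), if_neg h, map_zero]
    · rw [if_neg h, map_zero, apply_ite (sqCoeff K), sqCoeff_apply_monomial, if_neg h, map_zero,
        ite_self]
  exact LinearMap.congr_fun key f

lemma isHomogeneous_sqCoeff {K : Finset (Fin 5)} {m : ℕ} {f : P5}
    (hf : f.IsHomogeneous (K.card + 2 * m)) : (sqCoeff K f).IsHomogeneous m := by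
  have h := sqCoeff_homogeneousComponent K m f
  rw [homogeneousComponent_of_isHomogeneous hf, if_pos rfl] at h
  rw [h]
  exact homogeneousComponent_isHomogeneous _ _

lemma sqCoeff_eq_zero {K : Finset (Fin 5)} {n : ℕ} {f : P5} (hf : f.IsHomogeneous n)
    (hn : ∀ m, n ≠ K.card + 2 * m) : sqCoeff K f = 0 := by
  rw [← sum_homogeneousComponent (sqCoeff K f)]
  refine Finset.sum_eq_zero fun m _ => ?_
  rw [← sqCoeff_homogeneousComponent, homogeneousComponent_of_isHomogeneous hf, if_neg (hn m).symm,
    map_zero]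

lemma Sq_sqMul (K : Finset (Fin 5)) (z : P5) :
    Sq (sqMul K z) = ∑ t ∈ K.powerset, sqMul t (sqfree (K \ t) * Sq z) := by
  rw [sqMul_apply, map_mul, map_pow, sqfree, map_prod,
    Finset.prod_congr rfl fun i _ => show Sq (X i) = X i + X i ^ 2 by rw [Sq, aeval_X],
    Finset.prod_add, Finset.sum_mul]
  refine Finset.sum_congr rfl fun t _ => ?_
  rw [sqMul_apply, mul_pow, sqfree, sqfree, Finset.prod_pow, mul_assoc]

lemma sqCoeff_Sq_sqMul (J K : Finset (Fin 5)) (z : P5) :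
    sqCoeff J (Sq (sqMul K z)) = if J ⊆ K then sqfree (K \ J) * Sq z else 0 := by
  rw [Sq_sqMul, map_sum]
  simp only [sqCoeff_sqMul, Finset.sum_ite_eq, Finset.mem_powerset]

lemma Sq_sum_X_pow (i : Fin 5) (N : ℕ) :
    Sq (∑ j ∈ Finset.range N, X i ^ 2 ^ j) = X i + X i ^ 2 ^ N := by
  induction N with
  | zero => simp [CharTwo.add_self_eq_zero]
  | succ N ih =>
    rw [Finset.sum_range_succ, map_add, ih, map_pow, show Sq (X i) = X i + X i ^ 2 by
      rw [Sq, aeval_X], add_pow_char_pow, ← pow_mul, ← pow_succ', add_assoc, ← add_assoc (_ ^ _),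
      CharTwo.add_self_eq_zero, zero_add]

/-- A version of Wood's theorem: `sqfree K * v ^ 2` is hit when `K.card + deg v` is not a sum of
`K.card` powers of two. -/
lemma sqMul_mem_hitSpan {K : Finset (Fin 5)} {v : P5} {m : ℕ} (hv : v.IsHomogeneous m)
    (hK : ∀ q : Fin 5 → ℕ, ∑ i ∈ K, 2 ^ q i ≠ K.card + m) :
    sqMul K v ∈ hitSpan (K.card + 2 * m) := by
  set n := K.card + 2 * m with hn
  set g : P5 := (∏ i ∈ K, ∑ j ∈ Finset.range n, X i ^ 2 ^ j) * v with hg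
  have hX (i : Fin 5) (j : ℕ) : (X i ^ j : P5).IsHomogeneous j := by
    simpa using (isHomogeneous_X (ZMod 2) i).pow j
  have hg0 : homogeneousComponent n g = 0 := by
    rw [hg, Finset.prod_sum, Finset.sum_mul, map_sum]
    refine Finset.sum_eq_zero fun p _ => ?_
    have hp : (∏ x ∈ K.attach, (X x.1 : P5) ^ 2 ^ p x.1 x.2).IsHomogeneous
        (∑ x ∈ K.attach, 2 ^ p x.1 x.2) := IsHomogeneous.prod _ _ _ fun x _ => hX _ _
    rw [homogeneousComponent_of_isHomogeneous (hp.mul hv), if_neg]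
    intro h
    refine hK (fun i => if hi : i ∈ K then p i hi else 0) ?_
    rw [← Finset.sum_attach]
    simp only [Finset.coe_mem, dite_true]
    omega
  have hSq : homogeneousComponent n (Sq g) = sqMul K v := by
    have hN : n < 2 ^ n := Nat.lt_two_pow_self
    rw [hg, map_mul, map_prod, Finset.prod_congr rfl fun i _ => Sq_sum_X_pow i n,
      Finset.prod_add, Finset.sum_mul, map_sum, Finset.sum_eq_single K]
    · rw [Finset.sdiff_self, Finset.prod_empty, mul_one, hn]
      refine (homogeneousComponent_add_mul (isHomogeneous_sqfree K) _ _).trans ?_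
      rw [homogeneousComponent_Sq_two_mul hv, sqMul_apply]
    · intro t ht htK
      obtain ⟨i, hi⟩ : (K \ t).Nonempty := by
        rw [Finset.sdiff_nonempty]
        exact fun h => htK (Finset.Subset.antisymm (Finset.mem_powerset.1 ht) h)
      rw [← Finset.mul_prod_erase _ _ hi, mul_left_comm, mul_assoc]
      exact homogeneousComponent_mul_of_lt (hX i _) _ hN
    · simp
  rw [← hSq]
  exact homogeneousComponent_Sq_mem_hitSpan hg0

instance (n : ℕ) : FiniteDimensional (ZMod 2) (homogeneousSubmodule (Fin 5) (ZMod 2) n) := by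
  rw [homogeneousSubmodule_eq_span]
  refine FiniteDimensional.span_of_finite _ (((mons n).finite_toSet.image toMon).subset ?_)
  rintro f ⟨z, hz, rfl⟩
  exact ⟨z, hz, rfl⟩

/-- The dimension of a quotient `H ⧸ N` from a linear map on `H` whose kernel lies in `N`. -/
lemma finrank_quotient_add_finrank_map {E V : Type*} [AddCommGroup E] [Module (ZMod 2) E]
    [AddCommGroup V] [Module (ZMod 2) V] {H N : Submodule (ZMod 2) E}
    [FiniteDimensional (ZMod 2) H] (hN : N ≤ H) (f : E →ₗ[ZMod 2] V)
    (hker : ∀ x ∈ H, f x = 0 → x ∈ N) :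
    Module.finrank (ZMod 2) (H ⧸ N.comap H.subtype) + Module.finrank (ZMod 2) (N.map f) =
      Module.finrank (ZMod 2) (H.map f) := by
  set g := f.domRestrict H
  set M := N.comap H.subtype
  have hM : LinearMap.ker g ≤ M := fun x hx => hker x x.2 hx
  have h1 := M.finrank_quotient_add_finrank
  have h2 := (g.domRestrict M).finrank_range_add_finrank_ker
  have h3 := g.finrank_range_add_finrank_ker
  have h4 : LinearMap.range (g.domRestrict M) = N.map f := by
    rw [LinearMap.range_domRestrict]
    ext y
    constructor
    · rintro ⟨x, hx, rfl⟩
      exact ⟨x, hx, rfl⟩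
    · rintro ⟨x, hx, rfl⟩
      exact ⟨⟨x, hN hx⟩, hx, rfl⟩
  have h5 : LinearMap.range g = H.map f := LinearMap.range_domRestrict _ _
  have h6 : Module.finrank (ZMod 2) (LinearMap.ker (g.domRestrict M)) =
      Module.finrank (ZMod 2) (LinearMap.ker g) :=
    (Submodule.comapSubtypeEquivOfLe hM).finrank_eq
  rw [h4, h6] at h2
  rw [h5] at h3
  omega

lemma mem_hitSpan_of_sqCoeff {n : ℕ} {f : P5} (hf : f.IsHomogeneous n)
    (h : ∀ K m, n = Finset.card K + 2 * m →
      sqCoeff K f = 0 ∨ ∀ q : Fin 5 → ℕ, ∑ i ∈ K, 2 ^ q i ≠ K.card + m) :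
    f ∈ hitSpan n := by
  rw [← sum_sqMul_sqCoeff f]
  refine sum_mem fun K _ => ?_
  by_cases hK : ∀ m, n ≠ K.card + 2 * m
  · rw [sqCoeff_eq_zero hf hK, map_zero]
    exact zero_mem _
  · push Not at hK
    obtain ⟨m, rfl⟩ := hK
    rcases h K m rfl with h | h
    · rw [h, map_zero]
      exact zero_mem _
    · exact sqMul_mem_hitSpan (isHomogeneous_sqCoeff hf) h

lemma two_pow_cases (q : ℕ) : 2 ^ q = 1 ∨ 2 ^ q = 2 ∨ ∃ r, 2 ^ q = 4 * 2 ^ r := by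
  rcases q with _ | _ | q
  · simp
  · simp
  · exact Or.inr (Or.inr ⟨q, by ring⟩)

lemma two_pow_ne_of_card_eq_one {K : Finset (Fin 5)} (hK : K.card = 1) (q : Fin 5 → ℕ)
    {m t : ℕ} (hm : 1 + m + 2 = 14 * 2 ^ t) : ∑ i ∈ K, 2 ^ q i ≠ K.card + m := by
  obtain ⟨a, rfl⟩ := Finset.card_eq_one.1 hK
  rw [Finset.sum_singleton, Finset.card_singleton]
  have ht : 0 < 2 ^ t := by positivity
  obtain h | h | ⟨r, h⟩ := two_pow_cases (q a)
  · omega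
  · omega
  · rcases t with _ | t
    · obtain h1 | h1 | ⟨r', h1⟩ := two_pow_cases r <;> omega
    · rw [pow_succ] at hm
      omega

lemma two_pow_ne_of_card_eq_three {K : Finset (Fin 5)} (hK : K.card = 3) (q : Fin 5 → ℕ)
    {m t : ℕ} (hm : 3 + m + 1 = 28 * 2 ^ t) : ∑ i ∈ K, 2 ^ q i ≠ K.card + m := by
  rw [hK]
  obtain ⟨a, b, c, hab, hac, hbc, rfl⟩ := Finset.card_eq_three.1 hK
  rw [Finset.sum_insert (by simp [hab, hac]), Finset.sum_insert (by simp [hbc]),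
    Finset.sum_singleton]
  have key (r : ℕ) : 2 ^ r + 1 ≠ 7 * 2 ^ t := by
    intro h
    rcases t with _ | t
    · obtain h1 | h1 | ⟨r', h1⟩ := two_pow_cases r <;> omega
    · rcases r with _ | r
      · omega
      · rw [pow_succ, pow_succ] at h
        omega
  obtain h1 | h1 | ⟨r1, h1⟩ := two_pow_cases (q a) <;>
  obtain h2 | h2 | ⟨r2, h2⟩ := two_pow_cases (q b) <;>
  obtain h3 | h3 | ⟨r3, h3⟩ := two_pow_cases (q c) <;>
  rw [h1, h2, h3] <;>
  first
  | omega
  | (have := key r1; omega)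
  | (have := key r2; omega)
  | (have := key r3; omega)

lemma map_sqCoeff_univ_homogeneousSubmodule (m : ℕ) :
    (homogeneousSubmodule (Fin 5) (ZMod 2) (5 + 2 * m)).map (sqCoeff Finset.univ) =
      homogeneousSubmodule (Fin 5) (ZMod 2) m := by
  apply le_antisymm
  · rintro _ ⟨f, hf, rfl⟩
    exact isHomogeneous_sqCoeff (K := Finset.univ) hf
  · intro z hz
    exact ⟨sqMul Finset.univ z, isHomogeneous_sqMul Finset.univ hz,
      by rw [sqCoeff_sqMul, if_pos rfl]⟩

lemma map_sqCoeff_univ_hitSpan (m : ℕ) :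
    (hitSpan (5 + 2 * m)).map (sqCoeff Finset.univ) = hitSpan m := by
  have key (z : P5) : sqCoeff Finset.univ
      (homogeneousComponent (5 + 2 * m) (Sq (sqMul Finset.univ z))) =
        homogeneousComponent m (Sq z) := by
    refine (sqCoeff_homogeneousComponent Finset.univ m _).trans ?_
    rw [sqCoeff_Sq_sqMul, if_pos (Finset.Subset.refl _), Finset.sdiff_self, sqfree,
      Finset.prod_empty, one_mul]
  apply le_antisymm
  · rw [hitSpan_eq_span (5 + 2 * m), Submodule.map_span, Submodule.span_le]
    rintro _ ⟨_, ⟨e, he, rfl⟩, rfl⟩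
    have hd := degree_eq e
    rw [← sqMul_half]
    by_cases h : oddSupp e = Finset.univ
    · rw [h, key]
      rw [h, Finset.card_univ, Fintype.card_fin] at hd
      exact Submodule.subset_span ⟨_,
        mem_degLT_of_isHomogeneous (isHomogeneous_monomial_one (half e)) (by omega), rfl⟩
    · have : sqCoeff Finset.univ (homogeneousComponent (5 + 2 * m)
          (Sq (sqMul (oddSupp e) (monomial (half e) 1)))) = 0 := by
        refine (sqCoeff_homogeneousComponent Finset.univ m _).trans ?_
        rw [sqCoeff_Sq_sqMul, if_neg (fun h' => h (Finset.univ_subset_iff.1 h')), map_zero]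
      rw [this]
      exact zero_mem _
  · rw [hitSpan_eq_span m, Submodule.span_le]
    rintro _ ⟨e, he, rfl⟩
    rw [← key]
    refine Submodule.mem_map_of_mem (Submodule.subset_span ⟨_, ?_, rfl⟩)
    exact mem_degLT_of_isHomogeneous
      (isHomogeneous_sqMul Finset.univ (isHomogeneous_monomial_one e))
      (by rw [Finset.card_univ, Fintype.card_fin]; omega)

/-- Kameko's isomorphism in degrees `7 * 2 ^ s - 5`, on the level of dimensions. -/
lemma finrank_kameko (t : ℕ) :
    Module.finrank (ZMod 2) (homogeneousSubmodule (Fin 5) (ZMod 2) (7 * 2 ^ (t + 3) - 5) ⧸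
      (hitSpan (7 * 2 ^ (t + 3) - 5)).comap
        (homogeneousSubmodule (Fin 5) (ZMod 2) (7 * 2 ^ (t + 3) - 5)).subtype) =
    Module.finrank (ZMod 2) (homogeneousSubmodule (Fin 5) (ZMod 2) (7 * 2 ^ (t + 2) - 5) ⧸
      (hitSpan (7 * 2 ^ (t + 2) - 5)).comap
        (homogeneousSubmodule (Fin 5) (ZMod 2) (7 * 2 ^ (t + 2) - 5)).subtype) := by
  have ht : 0 < 2 ^ t := by positivity
  obtain ⟨m, hm⟩ : ∃ m, 7 * 2 ^ (t + 2) - 5 = m := ⟨_, rfl⟩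
  have hm' : m + 5 = 28 * 2 ^ t := by rw [pow_add] at hm; omega
  have hn : 7 * 2 ^ (t + 3) - 5 = 5 + 2 * m := by rw [pow_add] at *; omega
  rw [hm, hn]
  have h1 := finrank_quotient_add_finrank_map (hitSpan_le m) LinearMap.id
    fun f _ hf => by rw [show f = 0 from hf]; exact zero_mem _
  have h2 := finrank_quotient_add_finrank_map (hitSpan_le (5 + 2 * m)) (sqCoeff Finset.univ) ?_
  · rw [map_sqCoeff_univ_homogeneousSubmodule, map_sqCoeff_univ_hitSpan] at h2
    rw [Submodule.map_id, Submodule.map_id] at h1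
    exact Nat.add_right_cancel (h2.trans h1.symm)
  · intro f hf hf0
    refine mem_hitSpan_of_sqCoeff hf fun K k hk => ?_
    have hK : K.card ≤ 5 := (Finset.card_le_univ K).trans_eq (Fintype.card_fin 5)
    obtain h | h | h : K.card = 1 ∨ K.card = 3 ∨ K.card = 5 := by omega
    · exact Or.inr fun q => two_pow_ne_of_card_eq_one h q (t := t + 1) (by rw [pow_succ]; omega)
    · exact Or.inr fun q => two_pow_ne_of_card_eq_three h q (t := t) (by omega)
    · rw [(Finset.card_eq_iff_eq_univ K).1 (by rw [h, Fintype.card_fin])]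
      exact Or.inl hf0

/-- Does `f` hold on the whole list? -/
def allTrue {α : Type} (f : α → Bool) (l : List α) : Bool :=
  List.rec true (fun a _ ih => Bool.rec false (tramp ih) (f a)) l

/-- Read a number from a list. -/
def readEntry (_ : ℕ) (l : List ℕ) (k : ℕ → List ℕ → Bool) : Bool :=
  List.rec false (fun v l _ => tramp (k v l)) l

/-- Read a list of `r + 1` objects from a list of numbers, the sizes decreasing from `r` to `0`. -/
def readList {α : Type} (f : ℕ → List ℕ → (α → List ℕ → Bool) → Bool) (r : ℕ) :
    List ℕ → (List α → List ℕ → Bool) → Bool :=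
  Nat.rec (motive := fun _ => List ℕ → (List α → List ℕ → Bool) → Bool)
    (fun l k => f 0 l fun h l => k [h] l)
    (fun r ih l k => f (Nat.succ r) l fun h l => ih l fun t l => k (h :: t) l) r

/-- Arrange a list of numbers as a table indexed by the monomials of degree `d`. -/
def readTab (d : ℕ) (l : List ℕ) (k : Tab → Bool) : Bool :=
  readList (readList (readList (readList readEntry))) d l fun t _ => k t

/-- Prepend the rows of width `W` in the block `b` to a list, in reverse order. -/
def unpackRows (W n b : ℕ) : List ℕ → List ℕ :=
  Nat.rec (motive := fun _ => ℕ → List ℕ → List ℕ) (fun _ l => l)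
    (fun _ ih b l => ih (Nat.shiftRight b W) (Nat.mod b (Nat.pow 2 W) :: l)) n b

/-- Increase `k` as long as `2 ^ k` is found when running through the list. -/
def scanPowers (l : List ℕ) : ℕ → ℕ :=
  List.rec (motive := fun _ => ℕ → ℕ) (fun k => k)
    (fun v _ ih k => Bool.rec (ih k) (ih (Nat.succ k)) (Nat.beq v (Nat.shiftLeft 1 k))) l

/-- Concatenate blocks of 280 binary digits, the first one in the lowest position. -/
def joinBlocks (l : List ℕ) : ℕ :=
  List.rec 0 (fun a _ ih => Nat.xor (Nat.mod a (Nat.pow 2 280)) (Nat.shiftLeft ih 280)) l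

/-- The entry of a table at a monomial. -/
def entry (t : Tab) (z : Exps) : ℕ := tget t z.1 z.2.1 z.2.2.1 z.2.2.2.1

/-- The binary digits mark 280 monomials of degree 10 forming a basis modulo hit polynomials. -/
def basisMask : ℕ := 367630666515811741307398140659021543809365041779616848742367917320509861303899291685738343984867849857982421608852272792670812062116493266819315318052160816786961976121885805763186873874927626340356218877515337088883718910335308992569517442119364901107120484289248127449152704029011753557333270664

/-- Powers of two: the digits 0 among the lowest `n` binary digits of `m` get increasing exponents
from `i` on, the digits 1 decreasing exponents from `j` on. -/
def unitEntries (n : ℕ) : ℕ → ℕ → ℕ → List ℕ :=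
  Nat.rec (motive := fun _ => ℕ → ℕ → ℕ → List ℕ) (fun _ _ _ => [])
    (fun _ ih m i j => Bool.rec
      (Nat.shiftLeft 1 i :: ih (Nat.div m 2) (Nat.succ i) j)
      (Nat.shiftLeft 1 j :: ih (Nat.div m 2) i (Nat.pred j)) (Nat.beq (Nat.mod m 2) 1)) n

/-- The ten values of `t` on multiples of `z` by one variable different from the `c`-th one,
placed according to the triples of variables omitting the latter two. -/
def slotsFour (t : Tab) (z : Exps) (c : ℕ) : List ℕ :=
  (fun t0 t1 t2 t3 t4 => nth [] c [[t1, t2, t3, t4],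
    [t0, 0, 0, 0, t2, t3, t4], [0, t0, 0, 0, t1, 0, 0, t3, t4],
    [0, 0, t0, 0, 0, t1, 0, t2, 0, t4], [0, 0, 0, t0, 0, 0, t1, 0, t2, t3]])
  (tget t (Nat.succ z.1) z.2.1 z.2.2.1 z.2.2.2.1)
  (tget t z.1 (Nat.succ z.2.1) z.2.2.1 z.2.2.2.1)
  (tget t z.1 z.2.1 (Nat.succ z.2.2.1) z.2.2.2.1)
  (tget t z.1 z.2.1 z.2.2.1 (Nat.succ z.2.2.2.1))
  (tget t z.1 z.2.1 z.2.2.1 z.2.2.2.1)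

/-- The ten values of `t` on multiples of `z` by two distinct variables. -/
def slotsFive (t : Tab) (z : Exps) : List ℕ :=
  (fun a b c e => (fun a' b' c' e' => [
    tget t a' b' c e, tget t a' b c' e, tget t a' b c e', tget t a' b c e,
    tget t a b' c' e, tget t a b' c e', tget t a b' c e,
    tget t a b c' e', tget t a b c' e, tget t a b c e'])
  (Nat.succ a) (Nat.succ b) (Nat.succ c) (Nat.succ e)) z.1 z.2.1 z.2.2.1 z.2.2.2.1

/-- Do the rows, of width `W` and handled in blocks of `B`, have rank `n`? The row operations are
also applied to `qs`. -/
def rankCheck (W B n : ℕ) (rows qs : List ℕ) (k : List ℕ → Bool) : Bool :=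
  eliminate W B (Nat.pred (Nat.pow 2 W)) (ones W B) n
    (packRows W B (Nat.pred (Nat.pow 2 W)) rows B 0)
    (packRows W B (Nat.pred (Nat.pow 2 W)) qs B 0) k

/-- `T` detects the cokernel of the hit polynomials in degree 10, `P` the monomials of degree 9,
and `G` holds the values of `T` on multiples of monomials of degree 8. -/
def tabCheck (T P G : Tab) : Bool :=
  allTrue (fun b => b) [
    allTrue (fun z => Nat.beq (sqVal T 10 z) 0) (lowMons 10),
    Nat.beq (scanPowers ((mons 10).map (entry T)).reverse 0) 280,
    Nat.beq (scanPowers ((mons 9).map (entry P)) 0) 715,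
    allTrue (fun z => Nat.beq (entry G z) (joinBlocks (slotsFive T z))) (mons 8)]

/-- The rows spanning the image of the hit polynomials of degree 23. -/
def hitRows (T P G : Tab) : List ℕ :=
  (lowMons 9).map (fun z => Nat.xor (Nat.shiftLeft (sqVal G 8 z) 715)
    (Nat.mod (sqVal P 9 z) (Nat.pow 2 715))) ++
  (List.range 5).flatMap fun c => (mons 9).map fun z =>
    Nat.shiftLeft (joinBlocks (slotsFour T z c)) 715

/-- The hit polynomials of degree 10 have rank 721, and `k` holds for the table of the
projection to the cokernel. -/
def cokernelCheck (k : Tab → Bool) : Bool :=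
  (fun ids => readTab 10 ids fun I =>
    rankCheck 1001 77 721 ((lowMons 10).map (sqVal I 10)) ids fun qs =>
      readTab 10 (List.map (fun v => Nat.shiftRight v 721)
        (qs.flatMap fun b => unpackRows 1001 77 b [])) k)
  (unitEntries 1001 basisMask 0 1000)

/-- The whole computation. -/
def check : Bool :=
  cokernelCheck fun T => readTab 9 ((List.range 715).map fun i => Nat.shiftLeft 1 i) fun P =>
    readTab 8 ((mons 8).map fun z => joinBlocks (slotsFive T z)) fun G =>
      tramp (and (tabCheck T P G) (rankCheck 3515 32 2270 (hitRows T P G) [] fun _ => true))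

theorem check_eq_true : check = true := by decide +kernel

lemma allTrue_iff {α : Type} (f : α → Bool) (l : List α) :
    allTrue f l = true ↔ ∀ a ∈ l, f a = true := by
  induction l with
  | nil => simp [allTrue]
  | cons a l ih =>
    have e : allTrue f (a :: l) = Bool.rec false (allTrue f l) (f a) := rfl
    rw [e]
    cases h : f a <;> simp [h, ih]

lemma exists_of_readEntry (r : ℕ) (l : List ℕ) (k : ℕ → List ℕ → Bool)
    (h : readEntry r l k = true) : ∃ a l', k a l' = true := by
  cases l with
  | nil => exact absurd h Bool.false_ne_true
  | cons a l => exact ⟨a, l, h⟩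

lemma exists_of_readList {α : Type} {f : ℕ → List ℕ → (α → List ℕ → Bool) → Bool}
    (hf : ∀ r l k, f r l k = true → ∃ a l', k a l' = true) (r : ℕ) (l : List ℕ)
    (k : List α → List ℕ → Bool) (h : readList f r l k = true) : ∃ a l', k a l' = true := by
  induction r generalizing l k with
  | zero =>
    obtain ⟨a, l', h⟩ := hf _ _ _ h
    exact ⟨_, _, h⟩
  | succ r ih =>
    obtain ⟨a, l', h⟩ := hf _ _ _ h
    obtain ⟨t, l'', h⟩ := ih _ _ h
    exact ⟨_, _, h⟩

lemma exists_of_readTab {d : ℕ} {l : List ℕ} {k : Tab → Bool} (h : readTab d l k = true) :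
    ∃ t, k t = true := by
  obtain ⟨t, _, h⟩ := exists_of_readList (exists_of_readList (exists_of_readList
    (exists_of_readList exists_of_readEntry))) d l _ h
  exact ⟨t, h⟩

lemma rankCheck_spec {W B n : ℕ} {rows qs : List ℕ} {k : List ℕ → Bool} (hB : 0 < B)
    (h : rankCheck W B n rows qs k = true) :
    Module.finrank (ZMod 2) (Submodule.span (ZMod 2) {v | ∃ r ∈ rows, v = bits W r}) = n ∧
      ∃ qs, k qs = true := by
  obtain ⟨h1, h2⟩ := packRows_spec (W := W) hB rows B 0 le_rfl (by simp)
  obtain ⟨h3, h4⟩ := eliminate_spec n _ _ k h1 h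
  rw [h2, rowSpan_singleton_zero, bot_sup_eq] at h3
  exact ⟨h3, h4⟩

lemma two_pow_mem_of_scanPowers {l : List ℕ} {k m : ℕ} (h : scanPowers l k = m) {i : ℕ}
    (hk : k ≤ i) (hm : i < m) : 2 ^ i ∈ l := by
  induction l generalizing k with
  | nil =>
    have : k = m := h
    omega
  | cons v l ih =>
    have e : scanPowers (v :: l) k =
      Bool.rec (scanPowers l k) (scanPowers l (k + 1)) (Nat.beq v (Nat.shiftLeft 1 k)) := rfl
    rw [e] at h
    cases hv : Nat.beq v (Nat.shiftLeft 1 k) with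
    | false =>
      rw [hv] at h
      exact List.mem_cons_of_mem _ (ih h hk)
    | true =>
      rw [hv] at h
      rcases hk.eq_or_lt with rfl | hk
      · have hv : v = 1 <<< k := Nat.eq_of_beq_eq_true hv
        rw [hv, Nat.shiftLeft_eq, one_mul]
        exact List.mem_cons_self
      · exact List.mem_cons_of_mem _ (ih h hk)

lemma bits_two_pow {W : ℕ} (i : Fin W) : bits W (2 ^ (i : ℕ)) = Pi.single i 1 := by
  ext j
  rw [bits, Nat.testBit_two_pow, Pi.single_apply]
  simp [Fin.ext_iff, eq_comm]

lemma map_lin_eq_top {W : ℕ} {t : Tab} {d : ℕ} {l : List ℕ}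
    (hl : ∀ v ∈ l, v ∈ (mons d).map (entry t)) (h : scanPowers l 0 = W) :
    (homogeneousSubmodule (Fin 5) (ZMod 2) d).map (lin W t d) = ⊤ := by
  rw [eq_top_iff, ← (Pi.basisFun (ZMod 2) (Fin W)).span_eq, Submodule.span_le]
  rintro _ ⟨i, rfl⟩
  obtain ⟨z, hz, hzi⟩ :=
    List.mem_map.1 (hl _ (two_pow_mem_of_scanPowers h (Nat.zero_le i) i.isLt))
  have hz' := mem_mons.1 hz
  refine ⟨toMon z, ?_, ?_⟩
  · have := isHomogeneous_toMon z
    rwa [hz'] at this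
  · rw [lin_toMon, if_pos hz', Pi.basisFun_apply, ← bits_two_pow, ← hzi]
    rfl

lemma mem_of_map_eq_top {E V : Type*} [AddCommGroup E] [Module (ZMod 2) E]
    [AddCommGroup V] [Module (ZMod 2) V] {H N : Submodule (ZMod 2) E}
    [FiniteDimensional (ZMod 2) H] (hN : N ≤ H) (f : E →ₗ[ZMod 2] V) (hf : H.map f = ⊤)
    (hfN : ∀ x ∈ N, f x = 0)
    (hle : Module.finrank (ZMod 2) H ≤ Module.finrank (ZMod 2) N + Module.finrank (ZMod 2) V)
    {x : E} (hx : x ∈ H) (h : f x = 0) : x ∈ N := by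
  set K := H ⊓ LinearMap.ker f
  have hNK : N ≤ K := fun y hy => ⟨hN hy, hfN y hy⟩
  have : FiniteDimensional (ZMod 2) K := Submodule.finiteDimensional_of_le inf_le_left
  have h1 := (f.domRestrict H).finrank_range_add_finrank_ker
  rw [LinearMap.range_domRestrict, hf, finrank_top] at h1
  have hK : (LinearMap.ker (f.domRestrict H)).map H.subtype = K := by
    ext y
    simp [K, and_comm]
  have h2 := Submodule.finrank_map_subtype_eq H (LinearMap.ker (f.domRestrict H))
  rw [hK] at h2
  have h3 := Submodule.eq_of_le_of_finrank_le hNK (by omega)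
  rw [h3]
  exact ⟨hx, h⟩

set_option exponentiation.threshold 300 in
lemma testBit_joinBlocks (l : List ℕ) (n : ℕ) :
    (joinBlocks l).testBit n = (nth 0 (n / 280) l).testBit (n % 280) := by
  induction l generalizing n with
  | nil =>
    have : nth 0 (n / 280) ([] : List ℕ) = 0 := by cases n / 280 <;> rfl
    rw [this]
    simp [joinBlocks]
  | cons a l ih =>
    have e : joinBlocks (a :: l) = (a % 2 ^ 280) ^^^ (joinBlocks l <<< 280) := rfl
    rw [e, Nat.testBit_xor, Nat.testBit_mod_two_pow, Nat.testBit_shiftLeft]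
    by_cases h : n < 280
    · rw [Nat.div_eq_of_lt h, Nat.mod_eq_of_lt h]
      simp [h, not_le.2 h]
      rfl
    · have h1 : n / 280 = (n - 280) / 280 + 1 := by omega
      have h2 : n % 280 = (n - 280) % 280 := by omega
      rw [ih, h1, h2]
      simp [h, not_lt.1 h]
      rfl

/-- The triples of variables. -/
def triple (j : ℕ) : Finset (Fin 5) :=
  nth ∅ j [{2, 3, 4}, {1, 3, 4}, {1, 2, 4}, {1, 2, 3}, {0, 3, 4}, {0, 2, 4}, {0, 2, 3},
    {0, 1, 4}, {0, 1, 3}, {0, 1, 2}]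

lemma exists_triple_eq : ∀ K : Finset (Fin 5), K.card = 3 → ∃ j < 10, triple j = K := by
  decide +kernel

lemma card_triple : ∀ j < 10, (triple j).card = 3 := by decide +kernel

lemma triple_injective : ∀ i < 10, ∀ j < 10, triple i = triple j → i = j := by decide +kernel

lemma sqfree_mul_toMon (S : Finset (Fin 5)) (z : Exps) : sqfree S * toMon z =
    toMon (z.1 + if 0 ∈ S then 1 else 0, z.2.1 + if 1 ∈ S then 1 else 0,
      z.2.2.1 + if 2 ∈ S then 1 else 0, z.2.2.2.1 + if 3 ∈ S then 1 else 0,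
      z.2.2.2.2 + if 4 ∈ S then 1 else 0) := by
  have h : sqfree S = ∏ i, X i ^ (if i ∈ S then 1 else 0) := by
    simp [sqfree, Finset.prod_ite_mem]
  rw [h, Fin.prod_univ_five, toMon, toMon, mon, mon]
  simp only [pow_add]
  ring

lemma lin_sqfree_mul_toMon {W d : ℕ} (t : Tab) (S : Finset (Fin 5)) {z : Exps} (hz : z ∈ mons d) :
    lin W t (S.card + d) (sqfree S * toMon z) = bits W (tget t
      (z.1 + if 0 ∈ S then 1 else 0) (z.2.1 + if 1 ∈ S then 1 else 0)
      (z.2.2.1 + if 2 ∈ S then 1 else 0) (z.2.2.2.1 + if 3 ∈ S then 1 else 0)) := by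
  have h : S.card = ∑ i, if i ∈ S then 1 else 0 := by simp
  rw [Fin.sum_univ_five] at h
  rw [mem_mons] at hz
  rw [sqfree_mul_toMon, lin_toMon, if_pos]
  dsimp only
  omega

lemma lin_slotsFour (T : Tab) {z : Exps} (hz : z ∈ mons 9) (c : Fin 5) {j : ℕ} (hj : j < 10) :
    (if triple j ⊆ Finset.univ.erase c then
      lin 280 T 10 (sqfree (Finset.univ.erase c \ triple j) * toMon z) else 0) =
    bits 280 (nth 0 j (slotsFour T z c)) := by
  split_ifs with h
  · have hcard : (Finset.univ.erase c \ triple j).card = 1 := by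
      rw [Finset.card_sdiff_of_subset h, card_triple j hj]
      simp
    have := lin_sqfree_mul_toMon (W := 280) T (Finset.univ.erase c \ triple j) hz
    rw [hcard] at this
    rw [this]
    interval_cases j <;> fin_cases c <;> first | rfl | exact absurd h (by decide)
  · rw [← bits_zero]
    interval_cases j <;> fin_cases c <;> first | rfl | exact absurd (by decide) h

lemma lin_slotsFive (T : Tab) {z : Exps} (hz : z ∈ mons 8) {j : ℕ} (hj : j < 10) :
    lin 280 T 10 (sqfree (Finset.univ \ triple j) * toMon z) =
    bits 280 (nth 0 j (slotsFive T z)) := by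
  have hcard : (Finset.univ \ triple j).card = 2 := by
    rw [Finset.card_sdiff_of_subset (Finset.subset_univ _), card_triple j hj]
    rfl
  have := lin_sqfree_mul_toMon (W := 280) T (Finset.univ \ triple j) hz
  rw [hcard] at this
  rw [this]
  interval_cases j <;> rfl

lemma mod_lt_blockSize (i : ℕ) : i % 280 < 280 := Nat.mod_lt i (by decide)

/-- The map detecting hit polynomials of degree 23: the values of `P` on the coefficient of the
product of all variables, and those of `T` on the coefficients of the products of three. -/
def detect (T P : Tab) : P5 →ₗ[ZMod 2] (Fin 3515 → ZMod 2) := LinearMap.pi fun i =>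
  if h : (i : ℕ) < 715 then LinearMap.proj ⟨i, h⟩ ∘ₗ lin 715 P 9 ∘ₗ sqCoeff Finset.univ
  else LinearMap.proj ⟨(i - 715) % 280, mod_lt_blockSize _⟩ ∘ₗ
    lin 280 T 10 ∘ₗ sqCoeff (triple ((i - 715) / 280))

/-- The contribution of `sqfree K * f ^ 2` to the values of `T` detecting hit polynomials. -/
def tripleMap (T : Tab) (K : Finset (Fin 5)) : P5 →ₗ[ZMod 2] (Fin 3515 → ZMod 2) :=
  LinearMap.pi fun i => if (i : ℕ) < 715 then 0 else
    if triple ((i - 715) / 280) ⊆ K then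
      LinearMap.proj ⟨(i - 715) % 280, mod_lt_blockSize _⟩ ∘ₗ lin 280 T 10 ∘ₗ
        LinearMap.mulLeft (ZMod 2) (sqfree (K \ triple ((i - 715) / 280)))
    else 0

lemma detect_apply_of_lt (T P : Tab) (f : P5) (i : Fin 3515) (h : (i : ℕ) < 715) :
    detect T P f i = lin 715 P 9 (sqCoeff Finset.univ f) ⟨i, h⟩ := by
  simp [detect, h]

lemma detect_apply_of_not_lt (T P : Tab) (f : P5) (i : Fin 3515) (h : ¬ (i : ℕ) < 715) :
    detect T P f i = lin 280 T 10 (sqCoeff (triple ((i - 715) / 280)) f)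
      ⟨(i - 715) % 280, mod_lt_blockSize _⟩ := by
  simp [detect, h]

lemma tripleMap_apply_of_lt (T : Tab) (K : Finset (Fin 5)) (f : P5) (i : Fin 3515)
    (h : (i : ℕ) < 715) : tripleMap T K f i = 0 := by
  simp [tripleMap, h]

lemma tripleMap_apply_of_not_lt (T : Tab) (K : Finset (Fin 5)) (f : P5) (i : Fin 3515)
    (h : ¬ (i : ℕ) < 715) : tripleMap T K f i = lin 280 T 10
      (if triple ((i - 715) / 280) ⊆ K then sqfree (K \ triple ((i - 715) / 280)) * f else 0)
      ⟨(i - 715) % 280, mod_lt_blockSize _⟩ := by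
  rw [tripleMap, LinearMap.pi_apply, if_neg h]
  split_ifs
  · rfl
  · simp

lemma slot_lt_ten (i : Fin 3515) : ((i : ℕ) - 715) / 280 < 10 := by omega

lemma bits_apply_of_lt {a b : ℕ} (i : Fin 3515) (h : (i : ℕ) < 715) :
    bits 3515 (a <<< 715 ^^^ b % 2 ^ 715) i = bits 715 b ⟨i, h⟩ := by
  simp only [bits, Nat.testBit_xor, Nat.testBit_mod_two_pow, Nat.testBit_shiftLeft, h,
    not_le.2 h, decide_true, decide_false, Bool.true_and, Bool.false_and, Bool.false_xor]

lemma bits_apply_of_not_lt {a b : ℕ} (i : Fin 3515) (h : ¬ (i : ℕ) < 715) :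
    bits 3515 (a <<< 715 ^^^ b % 2 ^ 715) i = bits 2800 a ⟨i - 715, by omega⟩ := by
  simp only [bits, Nat.testBit_xor, Nat.testBit_mod_two_pow, Nat.testBit_shiftLeft, h,
    not_lt.1 h, decide_true, decide_false, Bool.true_and, Bool.false_and, Bool.xor_false]

lemma bits_joinBlocks (l : List ℕ) (i : ℕ) (hi : i < 2800) : bits 2800 (joinBlocks l) ⟨i, hi⟩ =
    bits 280 (nth 0 (i / 280) l) ⟨i % 280, mod_lt_blockSize i⟩ := by
  rw [bits, bits, testBit_joinBlocks]

lemma detect_homogeneousComponent (T P : Tab) (f : P5) :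
    detect T P (homogeneousComponent 23 f) = detect T P f := by
  ext i
  by_cases h : (i : ℕ) < 715
  · have := sqCoeff_homogeneousComponent Finset.univ 9 f
    rw [Finset.card_univ, Fintype.card_fin] at this
    rw [detect_apply_of_lt _ _ _ _ h, detect_apply_of_lt _ _ _ _ h, this,
      lin_homogeneousComponent]
  · have := sqCoeff_homogeneousComponent (triple ((i - 715) / 280)) 10 f
    rw [card_triple _ (slot_lt_ten i)] at this
    rw [detect_apply_of_not_lt _ _ _ _ h, detect_apply_of_not_lt _ _ _ _ h, this,
      lin_homogeneousComponent]

lemma detect_Sq_sqMul (T P : Tab) {K : Finset (Fin 5)} (hK : K ≠ Finset.univ) (z : P5) :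
    detect T P (Sq (sqMul K z)) = tripleMap T K (Sq z) := by
  ext i
  by_cases h : (i : ℕ) < 715
  · rw [detect_apply_of_lt _ _ _ _ h, tripleMap_apply_of_lt _ _ _ _ h, sqCoeff_Sq_sqMul,
      if_neg (fun h => hK (Finset.univ_subset_iff.1 h)), map_zero, Pi.zero_apply]
  · rw [detect_apply_of_not_lt _ _ _ _ h, tripleMap_apply_of_not_lt _ _ _ _ h, sqCoeff_Sq_sqMul]

lemma detect_Sq_sqMul_univ {T G : Tab} (P : Tab)
    (hG : ∀ z ∈ mons 8, entry G z = joinBlocks (slotsFive T z)) {z : Exps} (hz : z ∈ lowMons 9) :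
    detect T P (Sq (sqMul Finset.univ (toMon z))) =
      bits 3515 (sqVal G 8 z <<< 715 ^^^ sqVal P 9 z % 2 ^ 715) := by
  have hz' : z ∈ lowMons 10 := by rw [mem_lowMons] at *; omega
  ext i
  by_cases h : (i : ℕ) < 715
  · rw [detect_apply_of_lt _ _ _ _ h, bits_apply_of_lt _ h, sqCoeff_Sq_sqMul,
      if_pos (Finset.Subset.refl _), Finset.sdiff_self, sqfree, Finset.prod_empty, one_mul,
      lin_Sq_toMon _ _ _ hz']
  · have key : LinearMap.proj ⟨(i - 715) % 280, mod_lt_blockSize _⟩ ∘ₗ lin 280 T 10 ∘ₗ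
        LinearMap.mulLeft (ZMod 2) (sqfree (Finset.univ \ triple ((i - 715) / 280))) =
        LinearMap.proj (⟨i - 715, by omega⟩ : Fin 2800) ∘ₗ lin 2800 G 8 := by
      refine ext_toMon fun w => ?_
      simp only [LinearMap.comp_apply, LinearMap.proj_apply, LinearMap.mulLeft_apply]
      by_cases hw : w ∈ mons 8
      · rw [lin_slotsFive T hw (slot_lt_ten i), lin_toMon, if_pos (mem_mons.1 hw),
          show tget G w.1 w.2.1 w.2.2.1 w.2.2.2.1 = entry G w from rfl, hG w hw, bits_joinBlocks]
      · have hcard : (Finset.univ \ triple ((i - 715) / 280)).card = 2 := by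
          rw [Finset.card_sdiff_of_subset (Finset.subset_univ _), card_triple _ (slot_lt_ten i)]
          rfl
        rw [lin_toMon _ _ _ w, if_neg (fun h => hw (mem_mons.2 h)),
          ← lin_homogeneousComponent 280 T 10, homogeneousComponent_of_isHomogeneous
            ((isHomogeneous_sqfree _).mul (isHomogeneous_toMon w)), hcard, if_neg, map_zero]
        · rfl
        · rw [mem_mons] at hw
          omega
    rw [detect_apply_of_not_lt _ _ _ _ h, bits_apply_of_not_lt _ h, sqCoeff_Sq_sqMul,
      if_pos (Finset.subset_univ _), ← lin_Sq_toMon _ _ _ hz']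
    exact LinearMap.congr_fun key (Sq (toMon z))

lemma tripleMap_homogeneousComponent (T : Tab) {K : Finset (Fin 5)} (hK : K.card = 4) (f : P5) :
    tripleMap T K (homogeneousComponent 9 f) = tripleMap T K f := by
  ext i
  by_cases h : (i : ℕ) < 715
  · rw [tripleMap_apply_of_lt _ _ _ _ h, tripleMap_apply_of_lt _ _ _ _ h]
  · rw [tripleMap_apply_of_not_lt _ _ _ _ h, tripleMap_apply_of_not_lt _ _ _ _ h]
    split_ifs with hs
    · have := homogeneousComponent_add_mul (isHomogeneous_sqfree (K \ triple ((i - 715) / 280))) f 9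
      rw [Finset.card_sdiff_of_subset hs, card_triple _ (slot_lt_ten i), hK] at this
      rw [← this]
      exact congrFun (lin_homogeneousComponent 280 T 10 _) _
    · rfl

lemma tripleMap_toMon (T : Tab) (c : Fin 5) {z : Exps} (hz : z ∈ mons 9) :
    tripleMap T (Finset.univ.erase c) (toMon z) =
      bits 3515 (joinBlocks (slotsFour T z c) <<< 715) := by
  ext i
  have e : joinBlocks (slotsFour T z c) <<< 715 =
      joinBlocks (slotsFour T z c) <<< 715 ^^^ 0 % 2 ^ 715 := by
    rw [Nat.zero_mod, Nat.xor_zero]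
  rw [e]
  by_cases h : (i : ℕ) < 715
  · rw [tripleMap_apply_of_lt _ _ _ _ h, bits_apply_of_lt _ h, bits_zero, Pi.zero_apply]
  · rw [tripleMap_apply_of_not_lt _ _ _ _ h, bits_apply_of_not_lt _ h, bits_joinBlocks,
      ← lin_slotsFour T hz c (slot_lt_ten i), apply_ite (lin 280 T 10), map_zero]

lemma tripleMap_Sq_eq_zero {T : Tab} (hT : ∀ z ∈ lowMons 10, sqVal T 10 z = 0)
    {K : Finset (Fin 5)} {z : Exps} (hK : K.card < 3 ∨ K.card = 3 ∧ z ∈ lowMons 10) :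
    tripleMap T K (Sq (toMon z)) = 0 := by
  ext i
  by_cases h : (i : ℕ) < 715
  · rw [tripleMap_apply_of_lt _ _ _ _ h, Pi.zero_apply]
  · have hc := card_triple _ (slot_lt_ten i)
    rw [tripleMap_apply_of_not_lt _ _ _ _ h]
    split_ifs with hs
    · obtain ⟨hK, hz⟩ := hK.resolve_left (not_lt.2 (hc ▸ Finset.card_le_card hs))
      rw [Finset.eq_of_subset_of_card_le hs (by omega), Finset.sdiff_self, sqfree,
        Finset.prod_empty, one_mul, lin_Sq_toMon _ _ _ hz, hT z hz, bits_zero]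
      rfl
    · rw [map_zero, Pi.zero_apply, Pi.zero_apply]

lemma exists_eq_univ_erase : ∀ K : Finset (Fin 5), K.card = 4 → ∃ c, K = Finset.univ.erase c := by
  decide +kernel

lemma card_univ_erase : ∀ c : Fin 5, (Finset.univ.erase c).card = 4 := by decide +kernel

set_option exponentiation.threshold 800 in
lemma mem_hitRows {T P G : Tab} {r : ℕ} : r ∈ hitRows T P G ↔
    (∃ z ∈ lowMons 9, sqVal G 8 z <<< 715 ^^^ sqVal P 9 z % 2 ^ 715 = r) ∨
      ∃ c < 5, ∃ z ∈ mons 9, joinBlocks (slotsFour T z c) <<< 715 = r := by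
  rw [hitRows, List.mem_append, List.mem_map, List.mem_flatMap]
  simp only [List.mem_map, List.mem_range]
  rfl

lemma detect_Sq_mem (T P : Tab) {f : P5} {d : ℕ} (hf : f.IsHomogeneous d) (hd : d < 23) :
    detect T P (Sq f) ∈ (hitSpan 23).map (detect T P) := by
  rw [← detect_homogeneousComponent]
  exact Submodule.mem_map_of_mem
    (Submodule.subset_span ⟨f, mem_degLT_of_isHomogeneous hf hd, rfl⟩)

lemma map_detect_hitSpan {T G : Tab} (P : Tab) (hT : ∀ z ∈ lowMons 10, sqVal T 10 z = 0)
    (hG : ∀ z ∈ mons 8, entry G z = joinBlocks (slotsFive T z)) :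
    (hitSpan 23).map (detect T P) =
      Submodule.span (ZMod 2) {v | ∃ r ∈ hitRows T P G, v = bits 3515 r} := by
  apply le_antisymm
  · rw [hitSpan_eq_span, Submodule.map_span, Submodule.span_le]
    rintro _ ⟨_, ⟨e, he, rfl⟩, rfl⟩
    rw [detect_homogeneousComponent, ← sqMul_half, monomial_eq_toMon]
    rw [degree_eq, Finsupp.degree_eq_sum, Fin.sum_univ_five] at he
    generalize oddSupp e = K at *
    generalize half e = m at *
    have hK : K.card ≤ 5 := (Finset.card_le_univ K).trans_eq (Fintype.card_fin 5)
    rcases hK.eq_or_lt with hK | hK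
    · obtain rfl := (Finset.card_eq_iff_eq_univ K).1 (by rw [hK, Fintype.card_fin])
      have hz : (m 0, m 1, m 2, m 3, m 4) ∈ lowMons 9 := by
        rw [mem_lowMons]
        dsimp only
        omega
      rw [detect_Sq_sqMul_univ P hG hz]
      exact Submodule.subset_span ⟨_, mem_hitRows.2 (Or.inl ⟨_, hz, rfl⟩), rfl⟩
    · have hK' : K ≠ Finset.univ := fun h => by simp [h] at hK
      rw [detect_Sq_sqMul _ _ hK']
      by_cases hK4 : K.card = 4
      · obtain ⟨c, rfl⟩ := exists_eq_univ_erase K hK4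
        rw [← tripleMap_homogeneousComponent T hK4]
        have := Submodule.mem_map_of_mem (f := tripleMap T (Finset.univ.erase c))
          ((mem_homogeneousSubmodule _ _ ).2 (homogeneousComponent_isHomogeneous 9
            (Sq (toMon (m 0, m 1, m 2, m 3, m 4)))))
        rw [homogeneousSubmodule_eq_span, Submodule.map_span] at this
        refine Submodule.span_mono ?_ this
        rintro _ ⟨_, ⟨z, hz, rfl⟩, rfl⟩
        exact ⟨_, mem_hitRows.2 (Or.inr ⟨c, c.isLt, z, hz, rfl⟩), tripleMap_toMon T c hz⟩
      · rw [tripleMap_Sq_eq_zero hT]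
        · exact zero_mem _
        · rw [mem_lowMons]
          dsimp only
          omega
  · rw [Submodule.span_le]
    rintro _ ⟨r, hr, rfl⟩
    rcases mem_hitRows.1 hr with ⟨z, hz, rfl⟩ | ⟨c, hc, z, hz, rfl⟩
    · rw [mem_lowMons] at hz
      rw [← detect_Sq_sqMul_univ P hG (mem_lowMons.2 hz)]
      refine detect_Sq_mem T P (isHomogeneous_sqMul Finset.univ (isHomogeneous_toMon z)) ?_
      rw [Finset.card_univ, Fintype.card_fin]
      omega
    · lift c to Fin 5 using hc
      have hz9 := mem_mons.1 hz
      have hz' : homogeneousComponent 9 (Sq (toMon z)) = toMon z := by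
        rw [← hz9]
        exact homogeneousComponent_Sq_self (isHomogeneous_toMon z)
      have hc := card_univ_erase c
      rw [← tripleMap_toMon T c hz, ← hz', tripleMap_homogeneousComponent T hc,
        ← detect_Sq_sqMul T P (fun h => by simp [h] at hc)]
      refine detect_Sq_mem T P (isHomogeneous_sqMul _ (isHomogeneous_toMon z)) ?_
      omega

lemma exists_of_cokernelCheck {k : Tab → Bool} (h : cokernelCheck k = true) :
    (∃ I, Module.finrank (ZMod 2) (Submodule.span (ZMod 2)
      {v | ∃ r ∈ (lowMons 10).map (sqVal I 10), v = bits 1001 r}) = 721) ∧ ∃ T, k T = true := by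
  obtain ⟨I, h⟩ := exists_of_readTab h
  obtain ⟨h1, qs, h⟩ := rankCheck_spec (by decide) h
  obtain ⟨T, h⟩ := exists_of_readTab h
  exact ⟨⟨I, h1⟩, T, h⟩

lemma tabCheck_iff {T P G : Tab} : tabCheck T P G = true ↔
    (∀ z ∈ lowMons 10, sqVal T 10 z = 0) ∧
    scanPowers ((mons 10).map (entry T)).reverse 0 = 280 ∧
    scanPowers ((mons 9).map (entry P)) 0 = 715 ∧
    ∀ z ∈ mons 8, entry G z = joinBlocks (slotsFive T z) := by
  rw [tabCheck, allTrue_iff]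
  simp only [List.mem_cons, List.not_mem_nil, or_false, forall_eq_or_imp, forall_eq, allTrue_iff,
    Nat.beq_eq]

/-- What the computation shows. -/
lemma exists_tables :
    (∃ I, Module.finrank (ZMod 2) (Submodule.span (ZMod 2)
      {v | ∃ r ∈ (lowMons 10).map (sqVal I 10), v = bits 1001 r}) = 721) ∧
    ∃ T P G, tabCheck T P G = true ∧ Module.finrank (ZMod 2)
      (Submodule.span (ZMod 2) {v | ∃ r ∈ hitRows T P G, v = bits 3515 r}) = 2270 := by
  obtain ⟨h1, T, h⟩ := exists_of_cokernelCheck check_eq_true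
  obtain ⟨P, h⟩ := exists_of_readTab h
  obtain ⟨G, h⟩ := exists_of_readTab h
  obtain ⟨h2, h⟩ := Bool.and_eq_true_iff.1 h
  exact ⟨h1, T, P, G, h2, (rankCheck_spec (by decide) h).1⟩

instance (n : ℕ) : FiniteDimensional (ZMod 2) (hitSpan n) :=
  Submodule.finiteDimensional_of_le (hitSpan_le n)

lemma le_finrank_hitSpan_ten : 721 ≤ Module.finrank (ZMod 2) (hitSpan 10) := by
  obtain ⟨⟨I, h⟩, -⟩ := exists_tables
  refine h.symm.le.trans (le_trans ?_ (Submodule.finrank_map_le (lin 1001 I 10) (hitSpan 10)))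
  refine Submodule.finrank_mono (Submodule.span_le.2 ?_)
  rintro _ ⟨_, hr, rfl⟩
  obtain ⟨z, hz, rfl⟩ := List.mem_map.1 hr
  rw [← lin_Sq_toMon _ _ _ hz, ← lin_homogeneousComponent]
  exact Submodule.mem_map_of_mem (Submodule.subset_span ⟨_,
    mem_degLT_of_isHomogeneous (isHomogeneous_toMon z) (mem_lowMons.1 hz), rfl⟩)

lemma lin_eq_zero_of_mem_hitSpan_ten {W : ℕ} {T : Tab} (hT : ∀ z ∈ lowMons 10, sqVal T 10 z = 0) :
    ∀ f ∈ hitSpan 10, lin W T 10 f = 0 := by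
  rw [hitSpan_eq_span]
  refine fun f hf => LinearMap.mem_ker.1 (Submodule.span_le.2 ?_ hf)
  rintro _ ⟨e, he, rfl⟩
  rw [Finsupp.degree_eq_sum, Fin.sum_univ_five] at he
  rw [SetLike.mem_coe, LinearMap.mem_ker, lin_homogeneousComponent, monomial_eq_toMon]
  have hz : (e 0, e 1, e 2, e 3, e 4) ∈ lowMons 10 := mem_lowMons.2 he
  rw [lin_Sq_toMon _ _ _ hz, hT _ hz, bits_zero]

lemma mem_hitSpan_ten {T : Tab} (hT : ∀ z ∈ lowMons 10, sqVal T 10 z = 0)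
    (hT' : (homogeneousSubmodule (Fin 5) (ZMod 2) 10).map (lin 280 T 10) = ⊤) {f : P5}
    (hf : f.IsHomogeneous 10) (h : lin 280 T 10 f = 0) : f ∈ hitSpan 10 := by
  refine mem_of_map_eq_top (hitSpan_le 10) _ hT' (lin_eq_zero_of_mem_hitSpan_ten hT) ?_ hf h
  have h1 := finrank_homogeneousSubmodule_le 10
  have h2 : (mons 10).length = 1001 := by decide +kernel
  rw [Module.finrank_fin_fun]
  exact (h1.trans h2.le).trans (Nat.add_le_add_right le_finrank_hitSpan_ten 280)

lemma eq_zero_of_lin_nine {P : Tab}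
    (hP : (homogeneousSubmodule (Fin 5) (ZMod 2) 9).map (lin 715 P 9) = ⊤) {f : P5}
    (hf : f.IsHomogeneous 9) (h : lin 715 P 9 f = 0) : f = 0 := by
  refine (Submodule.mem_bot (ZMod 2)).1 (mem_of_map_eq_top bot_le _ hP ?_ ?_ hf h)
  · intro x hx
    rw [(Submodule.mem_bot (ZMod 2)).1 hx, map_zero]
  · have h1 := finrank_homogeneousSubmodule_le 9
    have h2 : (mons 9).length = 715 := by decide +kernel
    rw [Module.finrank_fin_fun]
    exact (h1.trans h2.le).trans (Nat.le_add_left 715 _)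

lemma exists_mem_hitSpan_sqCoeff {K : Finset (Fin 5)} {m : ℕ} {f : P5} (hf : f ∈ hitSpan m) :
    ∃ g ∈ hitSpan (K.card + 2 * m), ∀ J, K.card ≤ J.card →
      sqCoeff J g = if J = K then f else 0 := by
  rw [hitSpan_eq_span] at hf
  induction hf using Submodule.span_induction with
  | mem f hf =>
    obtain ⟨e, he, rfl⟩ := hf
    have hd := isHomogeneous_sqMul K (isHomogeneous_monomial_one e)
    refine ⟨_, Submodule.subset_span ⟨_, mem_degLT_of_isHomogeneous hd (by omega), rfl⟩,
      fun J hJ => ?_⟩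
    by_cases h : J = K
    · subst h
      rw [sqCoeff_homogeneousComponent, sqCoeff_Sq_sqMul, if_pos (Finset.Subset.refl _),
        Finset.sdiff_self, sqfree, Finset.prod_empty, one_mul, if_pos rfl]
    · rw [if_neg h]
      have hh : (homogeneousComponent (K.card + 2 * m) (Sq (sqMul K (monomial e 1)))).IsHomogeneous
        (K.card + 2 * m) := homogeneousComponent_isHomogeneous _ _
      by_cases hk : ∀ k, K.card + 2 * m ≠ J.card + 2 * k
      · exact sqCoeff_eq_zero hh hk
      · push Not at hk
        obtain ⟨k, hk⟩ := hk
        rw [hk, sqCoeff_homogeneousComponent, sqCoeff_Sq_sqMul,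
          if_neg fun h' => h (Finset.eq_of_subset_of_card_le h' hJ), map_zero]
  | zero => exact ⟨0, zero_mem _, fun J _ => by simp⟩
  | add f g _ _ hf hg =>
    obtain ⟨f', hf, hf'⟩ := hf
    obtain ⟨g', hg, hg'⟩ := hg
    refine ⟨_, add_mem hf hg, fun J hJ => ?_⟩
    rw [map_add, hf' J hJ, hg' J hJ]
    split_ifs <;> simp
  | smul a f _ hf =>
    obtain ⟨f', hf, hf'⟩ := hf
    refine ⟨_, Submodule.smul_mem _ a hf, fun J hJ => ?_⟩
    rw [map_smul, hf' J hJ]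
    split_ifs <;> simp

lemma mem_hitSpan_of_sqCoeff_triple {f : P5} (hf : f.IsHomogeneous 23)
    (h5 : sqCoeff Finset.univ f = 0)
    (h3 : ∀ K : Finset (Fin 5), K.card = 3 → sqCoeff K f ∈ hitSpan 10) : f ∈ hitSpan 23 := by
  have key (K : Finset (Fin 5)) : ∃ g ∈ hitSpan 23, ∀ J, 3 ≤ J.card →
      sqCoeff J g = if K.card = 3 ∧ J = K then sqCoeff K f else 0 := by
    by_cases hK : K.card = 3
    · obtain ⟨g, hg, hg'⟩ := exists_mem_hitSpan_sqCoeff (K := K) (h3 K hK)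
      rw [hK] at hg hg'
      exact ⟨g, hg, fun J hJ => by rw [hg' J hJ]; simp [hK]⟩
    · exact ⟨0, zero_mem _, fun J _ => by simp [hK]⟩
  choose g hg hg' using key
  have hs : ∑ K, g K ∈ hitSpan 23 := sum_mem fun K _ => hg K
  rw [← Submodule.sub_mem_iff_left _ hs]
  refine mem_hitSpan_of_sqCoeff (Submodule.sub_mem _ hf (hitSpan_le 23 hs)) fun K m hm => ?_
  have hK : K.card ≤ 5 := (Finset.card_le_univ K).trans_eq (Fintype.card_fin 5)
  obtain h | h | h : K.card = 1 ∨ K.card = 3 ∨ K.card = 5 := by omega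
  · exact Or.inr fun q => two_pow_ne_of_card_eq_one h q (t := 0) (by omega)
  · left
    rw [map_sub, map_sum, Finset.sum_eq_single K, hg' K K h.ge, if_pos ⟨h, rfl⟩, sub_self]
    · exact fun J _ hJ => by rw [hg' J K h.ge, if_neg fun h' => hJ h'.2.symm]
    · simp
  · left
    have hKu := (Finset.card_eq_iff_eq_univ K).1 (by rw [h, Fintype.card_fin])
    rw [map_sub, map_sum, hKu, h5, zero_sub, neg_eq_zero, ← hKu]
    refine Finset.sum_eq_zero fun J _ => ?_
    rw [hg' J K (by omega), if_neg]
    rintro ⟨hJ, rfl⟩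
    omega

lemma mem_hitSpan_of_detect_eq_zero {T P : Tab} (hT : ∀ z ∈ lowMons 10, sqVal T 10 z = 0)
    (hT' : (homogeneousSubmodule (Fin 5) (ZMod 2) 10).map (lin 280 T 10) = ⊤)
    (hP : (homogeneousSubmodule (Fin 5) (ZMod 2) 9).map (lin 715 P 9) = ⊤) {f : P5}
    (hf : f.IsHomogeneous 23) (h : detect T P f = 0) : f ∈ hitSpan 23 := by
  refine mem_hitSpan_of_sqCoeff_triple hf ?_ fun K hK => ?_
  · refine eq_zero_of_lin_nine hP (isHomogeneous_sqCoeff (K := Finset.univ) hf) ?_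
    ext i
    rw [← detect_apply_of_lt T P f ⟨i, by omega⟩ i.isLt, h]
    rfl
  · have hf' : (sqCoeff K f).IsHomogeneous 10 := isHomogeneous_sqCoeff (by rwa [hK])
    refine mem_hitSpan_ten hT hT' hf' ?_
    obtain ⟨j, hj, rfl⟩ := exists_triple_eq K hK
    ext k
    have := detect_apply_of_not_lt T P f ⟨715 + 280 * j + k, by omega⟩ (by dsimp only; omega)
    have e1 : (715 + 280 * j + k - 715) / 280 = j := by omega
    have e2 : (715 + 280 * j + k - 715) % 280 = k := by omega
    simp only [h, e1, e2] at this
    exact this.symm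

lemma triple_ne_univ {j : ℕ} (hj : j < 10) : triple j ≠ Finset.univ := fun h => by
  simpa [h] using card_triple j hj

lemma map_detect_homogeneousSubmodule {T P : Tab}
    (hT' : (homogeneousSubmodule (Fin 5) (ZMod 2) 10).map (lin 280 T 10) = ⊤)
    (hP : (homogeneousSubmodule (Fin 5) (ZMod 2) 9).map (lin 715 P 9) = ⊤) :
    (homogeneousSubmodule (Fin 5) (ZMod 2) 23).map (detect T P) = ⊤ := by
  refine eq_top_iff.2 fun v _ => ?_
  have hT (w : Fin 280 → ZMod 2) : ∃ f : P5, f.IsHomogeneous 10 ∧ lin 280 T 10 f = w :=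
    (eq_top_iff.1 hT' (Submodule.mem_top (x := w)))
  obtain ⟨p, hp, hpv⟩ : ∃ p : P5, p.IsHomogeneous 9 ∧ lin 715 P 9 p =
      fun i : Fin 715 => v ⟨i, by omega⟩ :=
    (eq_top_iff.1 hP Submodule.mem_top)
  choose f hf hfv using fun j : Fin 10 => hT fun k => v ⟨715 + 280 * j + k, by omega⟩
  refine ⟨∑ j : Fin 10, sqMul (triple j) (f j) + sqMul Finset.univ p, ?_, ?_⟩
  · refine Submodule.add_mem _ (Submodule.sum_mem _ fun j _ => ?_)
      (isHomogeneous_sqMul Finset.univ hp)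
    have := isHomogeneous_sqMul (triple j) (hf j)
    rwa [card_triple j j.isLt] at this
  · ext i
    by_cases h : (i : ℕ) < 715
    · rw [detect_apply_of_lt _ _ _ _ h, map_add, map_sum, sqCoeff_sqMul, if_pos rfl,
        Finset.sum_eq_zero, zero_add, hpv]
      exact fun j _ => by rw [sqCoeff_sqMul, if_neg (triple_ne_univ j.isLt).symm]
    · have hj := slot_lt_ten i
      have hi : 715 + 280 * (((i : ℕ) - 715) / 280) + ((i : ℕ) - 715) % 280 = i := by omega
      rw [detect_apply_of_not_lt _ _ _ _ h, map_add, map_sum, sqCoeff_sqMul,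
        if_neg (triple_ne_univ hj), add_zero,
        Finset.sum_eq_single (⟨((i : ℕ) - 715) / 280, hj⟩ : Fin 10), sqCoeff_sqMul, if_pos rfl, hfv]
      · exact congrArg v (Fin.ext hi)
      · intro j _ hne
        rw [sqCoeff_sqMul, if_neg]
        exact fun h' => hne (Fin.ext (triple_injective _ hj _ j.isLt h').symm)
      · simp

lemma finrank_base :
    Module.finrank (ZMod 2) (homogeneousSubmodule (Fin 5) (ZMod 2) 23 ⧸
      (hitSpan 23).comap (homogeneousSubmodule (Fin 5) (ZMod 2) 23).subtype) = 1245 := by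
  obtain ⟨-, T, P, G, h, hr⟩ := exists_tables
  obtain ⟨hT, hs, hp, hG⟩ := tabCheck_iff.1 h
  have hT' := map_lin_eq_top (fun v hv => List.mem_reverse.1 hv) hs
  have hP := map_lin_eq_top (fun v hv => hv) hp
  have := finrank_quotient_add_finrank_map (hitSpan_le 23) (detect T P)
    fun f hf h => mem_hitSpan_of_detect_eq_zero hT hT' hP hf h
  rw [map_detect_hitSpan P hT hG, hr, map_detect_homogeneousSubmodule hT' hP, finrank_top,
    Module.finrank_fin_fun] at this
  exact Nat.add_right_cancel (m := 2270) this

/-- For every `s ≥ 2`, `dim_{F_2} (QP_5)_{7·2^s − 5} = 1245`. -/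
theorem stmt2 (s : ℕ) (hs : 2 ≤ s) :
    Module.finrank (ZMod 2)
      (↥(homogeneousSubmodule (Fin 5) (ZMod 2) (7 * 2 ^ s - 5)) ⧸
        Submodule.comap (homogeneousSubmodule (Fin 5) (ZMod 2) (7 * 2 ^ s - 5)).subtype
          (hitSpan (7 * 2 ^ s - 5))) = 1245 := by
  obtain ⟨t, rfl⟩ := Nat.exists_eq_add_of_le' hs
  clear hs
  induction t with
  | zero => exact finrank_base
  | succ t ih => exact (finrank_kameko t).trans ih
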